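/- arXiv:2401.03450 — 7 statements merged into one kernel-verified Lean document; each statement's English description precedes it below -/
import Mathlib

section
/- Let n ≥ 2 and let P₁,…,Pₙ be cameras with pairwise distinct camera centers p₁,…,pₙ ∈ ℙ³. Let x and x′ be points of ℙ³, neither equal to any camera center, such that for every i the points Pᵢx and Pᵢx′ of ℙ² coincide. If the camera centers p₁,…,pₙ do not all lie on a single projective line, then x = x′. If the camera centers all lie on a projective line L, then either x = x′ or both x and x′ lie on L. -/
open Matrix

noncomputable section

/-- `ℙ³ = ℙ(ℂ⁴)`. -/
abbrev P3 := Projectivization ℂ (Fin 4 → ℂ)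

/-- Complexification of a real matrix. -/
def cx {m n : Type*} (A : Matrix m n ℝ) : Matrix m n ℂ :=
  A.map (fun a => (a : ℂ))

/-- `x ∈ ℙ³` is the camera center of the camera `P`. -/
def IsCenter (P : Matrix (Fin 3) (Fin 4) ℝ) (x : P3) : Prop :=
  (cx P).mulVec x.rep = 0

/-- The points `x` and `y` of `ℙ³` have the same image in `ℙ²` under the cameras
`P` and `Q` respectively. -/
def SameImage (P Q : Matrix (Fin 3) (Fin 4) ℝ) (x y : P3) : Prop :=
  ∃ c : ℂ, c ≠ 0 ∧ (cx P).mulVec x.rep = c • (cx Q).mulVec y.rep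

/-- `(P, X)` is a valid configuration: all cameras have rank 3, the camera centers are
pairwise distinct, and no point of `X` is a camera center. -/
def ValidConfig (n : ℕ) (P : Fin n → Matrix (Fin 3) (Fin 4) ℝ) (X : Set P3) : Prop :=
  (∀ i, (P i).rank = 3) ∧
  (∀ i j : Fin n, i ≠ j → ∀ z : P3, IsCenter (P i) z → ¬ IsCenter (P j) z) ∧
  (∀ x ∈ X, ∀ i, ¬ IsCenter (P i) x)

/-- The configurations `(P, X)` and `(Q, Y)` are projectively equivalent via some
`H ∈ GL₄(ℝ)`: `H · X = Y` and `Pᵢ H⁻¹` is a nonzero real multiple of `Qᵢ` for all `i`. -/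
def ProjEquiv (n : ℕ) (P Q : Fin n → Matrix (Fin 3) (Fin 4) ℝ) (X Y : Set P3) : Prop :=
  ∃ H : Matrix (Fin 4) (Fin 4) ℝ, IsUnit H ∧
    (∀ x ∈ X, ∃ y ∈ Y, ∃ c : ℂ, c ≠ 0 ∧ (cx H).mulVec x.rep = c • y.rep) ∧
    (∀ y ∈ Y, ∃ x ∈ X, ∃ c : ℂ, c ≠ 0 ∧ (cx H).mulVec x.rep = c • y.rep) ∧
    (∀ i, ∃ l : ℝ, l ≠ 0 ∧ P i * H⁻¹ = l • Q i)

/-- `(Q, Y)` is a conjugate configuration of `(P, X)`: it is a valid configuration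
producing the same images, and it is not projectively equivalent to `(P, X)`. -/
def IsConjugate (n : ℕ) (P : Fin n → Matrix (Fin 3) (Fin 4) ℝ) (X : Set P3)
    (Q : Fin n → Matrix (Fin 3) (Fin 4) ℝ) (Y : Set P3) : Prop :=
  ValidConfig n Q Y ∧
  (∀ x ∈ X, ∃ y ∈ Y, ∀ i, SameImage (P i) (Q i) x y) ∧
  (∀ y ∈ Y, ∃ x ∈ X, ∀ i, SameImage (P i) (Q i) x y) ∧
  ¬ ProjEquiv n P Q X Y

/-- The configuration `(P, X)` is critical: it admits a conjugate configuration. -/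
def IsCritical (n : ℕ) (P : Fin n → Matrix (Fin 3) (Fin 4) ℝ) (X : Set P3) : Prop :=
  ∃ Q Y, IsConjugate n P X Q Y

/-- The 6×6 matrix whose first three rows are the blocks `(P₁ | x | 0)` and whose last
three rows are the blocks `(P₂ | 0 | y)`. -/
def bigM (P₁ P₂ : Matrix (Fin 3) (Fin 4) ℝ) (x y : Fin 3 → ℝ) :
    Matrix (Fin 6) (Fin 6) ℝ :=
  Matrix.of fun i j =>
    if hi : (i : ℕ) < 3 then
      if hj : (j : ℕ) < 4 then P₁ ⟨(i : ℕ), hi⟩ ⟨(j : ℕ), hj⟩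
      else if (j : ℕ) = 4 then x ⟨(i : ℕ), hi⟩
      else 0
    else
      if hj : (j : ℕ) < 4 then
        P₂ ⟨(i : ℕ) - 3, by have := i.isLt; omega⟩ ⟨(j : ℕ), hj⟩
      else if (j : ℕ) = 4 then 0
      else y ⟨(i : ℕ) - 3, by have := i.isLt; omega⟩

/-- `F` is the fundamental matrix of the ordered camera pair `(P₁, P₂)`:
`xᵀ F y = det M(x, y)` for all `x, y ∈ ℝ³`. -/
def IsFundamental (P₁ P₂ : Matrix (Fin 3) (Fin 4) ℝ)
    (F : Matrix (Fin 3) (Fin 3) ℝ) : Prop :=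
  ∀ x y : Fin 3 → ℝ, x ⬝ᵥ F.mulVec y = (bigM P₁ P₂ x y).det

/-- The configuration `(P, X)` is non-trivially critical: it admits a conjugate
configuration whose fundamental matrices are not real scalar multiples of those of `P`. -/
def IsNontrivCritical (n : ℕ) (P : Fin n → Matrix (Fin 3) (Fin 4) ℝ)
    (X : Set P3) : Prop :=
  ∃ Q Y, IsConjugate n P X Q Y ∧
    ∀ i j : Fin n, i < j →
      ∀ FP FQ : Matrix (Fin 3) (Fin 3) ℝ,
        IsFundamental (P i) (P j) FP → IsFundamental (Q i) (Q j) FQ →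
        ∀ l : ℝ, FQ ≠ l • FP

/-- Complexification is multiplicative. -/
lemma cx_mul {l m n : Type*} [Fintype m] (A : Matrix l m ℝ) (B : Matrix m n ℝ) :
    cx (A * B) = cx A * cx B :=
  Matrix.map_mul (f := Complex.ofRealHom)

/-- A real matrix of full row rank has surjective complexification. -/
lemma cx_mulVec_surjective {m n : Type*} [Fintype m] [DecidableEq m] [Fintype n]
    {A : Matrix m n ℝ} (hA : A.rank = Fintype.card m) :
    Function.Surjective (cx A).mulVec := by
  have hsurj : Function.Surjective A.mulVec := by
    have htop : LinearMap.range A.mulVecLin = ⊤ :=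
      Submodule.eq_top_of_finrank_eq (by simpa [Matrix.rank] using hA)
    exact LinearMap.range_eq_top.1 htop
  obtain ⟨B, hB⟩ := Matrix.mulVec_surjective_iff_exists_right_inverse.1 hsurj
  refine Matrix.mulVec_surjective_iff_exists_right_inverse.2 ⟨cx B, ?_⟩
  rw [← cx_mul, hB]
  exact Matrix.map_one _ Complex.ofReal_zero Complex.ofReal_one

/-- The kernel of a camera is spanned by its center. -/
lemma IsCenter.exists_smul_eq {P : Matrix (Fin 3) (Fin 4) ℝ} (hP : P.rank = 3) {c : P3}
    (hc : IsCenter P c) {v : Fin 4 → ℂ} (hv : (cx P).mulVec v = 0) :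
    ∃ a : ℂ, a • c.rep = v := by
  have hrange : LinearMap.range (cx P).mulVecLin = ⊤ :=
    LinearMap.range_eq_top.2 (cx_mulVec_surjective (by simpa using hP))
  have hker : Module.finrank ℂ (LinearMap.ker (cx P).mulVecLin) = 1 := by
    have h := LinearMap.finrank_range_add_finrank_ker (cx P).mulVecLin
    rw [hrange] at h
    simp only [finrank_top, Module.finrank_fin_fun] at h
    omega
  obtain ⟨a, ha⟩ := exists_smul_eq_of_finrank_eq_one hker
    (x := ⟨c.rep, hc⟩) (fun h => c.rep_nonzero (congrArg Subtype.val h)) ⟨v, hv⟩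
  exact ⟨a, congrArg Subtype.val ha⟩

/-- Distinct points of projective space have linearly independent representatives. -/
lemma P3.linearIndependent_rep {x y : P3} (h : x ≠ y) :
    LinearIndependent ℂ ![x.rep, y.rep] := by
  rw [LinearIndependent.pair_iff' x.rep_nonzero]
  intro a ha
  apply h
  rw [← x.mk_rep, ← y.mk_rep, Projectivization.mk_eq_mk_iff']
  by_cases ha0 : a = 0
  · exact absurd (by simpa [ha0] using ha.symm) y.rep_nonzero
  · exact ⟨a⁻¹, by rw [← ha, inv_smul_smul₀ ha0]⟩

/-- The line through two distinct points of projective space. -/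
lemma P3.finrank_span_rep {x y : P3} (h : x ≠ y) :
    Module.finrank ℂ (Submodule.span ℂ {x.rep, y.rep}) = 2 := by
  have hspan := finrank_span_eq_card (P3.linearIndependent_rep h)
  rwa [Matrix.range_cons_cons_empty, Fintype.card_fin] at hspan

/-- If two distinct points have the same image, the camera center lies on their line. -/
lemma IsCenter.rep_mem_span {P : Matrix (Fin 3) (Fin 4) ℝ} (hP : P.rank = 3) {c : P3}
    (hc : IsCenter P c) {x y : P3} (hxy : x ≠ y) {γ : ℂ}
    (h : (cx P).mulVec x.rep = γ • (cx P).mulVec y.rep) :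
    c.rep ∈ Submodule.span ℂ {x.rep, y.rep} := by
  obtain ⟨a, ha⟩ := hc.exists_smul_eq hP (v := x.rep - γ • y.rep)
    (by rw [Matrix.mulVec_sub, Matrix.mulVec_smul, h, sub_self])
  have ha0 : a ≠ 0 := by
    rintro rfl
    have hlin := LinearIndependent.pair_iff.1 (P3.linearIndependent_rep hxy) 1 (-γ)
      (by rw [one_smul, neg_smul, ← sub_eq_add_neg, ← ha, zero_smul])
    exact one_ne_zero hlin.1
  rw [← Submodule.smul_mem_iff _ ha0, ha]
  exact Submodule.sub_mem _ (Submodule.subset_span (by simp))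
    (Submodule.smul_mem _ _ (Submodule.subset_span (by simp)))

theorem statement0 (n : ℕ) (hn : 2 ≤ n)
    (P : Fin n → Matrix (Fin 3) (Fin 4) ℝ)
    (hrank : ∀ i, (P i).rank = 3)
    (c : Fin n → P3)
    (hc : ∀ i, IsCenter (P i) (c i))
    (hdist : ∀ i j : Fin n, i ≠ j → c i ≠ c j)
    (x x' : P3)
    (hx : ∀ i, ¬ IsCenter (P i) x)
    (hx' : ∀ i, ¬ IsCenter (P i) x')
    (him : ∀ i, ∃ γ : ℂ, γ ≠ 0 ∧
      (cx (P i)).mulVec x.rep = γ • (cx (P i)).mulVec x'.rep) :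
    ((¬ ∃ W : Submodule ℂ (Fin 4 → ℂ), Module.finrank ℂ W = 2 ∧ ∀ i, (c i).rep ∈ W) →
        x = x') ∧
    (∀ W : Submodule ℂ (Fin 4 → ℂ), Module.finrank ℂ W = 2 → (∀ i, (c i).rep ∈ W) →
        x = x' ∨ (x.rep ∈ W ∧ x'.rep ∈ W)) := by
  have hmem (hne : x ≠ x') (i : Fin n) : (c i).rep ∈ Submodule.span ℂ {x.rep, x'.rep} := by
    obtain ⟨γ, -, h⟩ := him i
    exact (hc i).rep_mem_span (hrank i) hne h
  refine ⟨fun hW => by_contra fun hne => hW ⟨_, P3.finrank_span_rep hne, hmem hne⟩,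
    fun W hW hcW => or_iff_not_imp_left.2 fun hne => ?_⟩
  have h01 : c ⟨0, by omega⟩ ≠ c ⟨1, by omega⟩ := hdist _ _ (by simp)
  have hline {V : Submodule ℂ (Fin 4 → ℂ)} (hV : Module.finrank ℂ V = 2)
      (hcV : ∀ i, (c i).rep ∈ V) :
      Submodule.span ℂ {(c ⟨0, by omega⟩).rep, (c ⟨1, by omega⟩).rep} = V := by
    refine Submodule.eq_of_le_of_finrank_eq (Submodule.span_le.2 ?_) ?_
    · rintro v (rfl | rfl)
      exacts [hcV _, hcV _]
    · rw [hV, P3.finrank_span_rep h01]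
  have hspan : Submodule.span ℂ {x.rep, x'.rep} = W :=
    (hline (P3.finrank_span_rep hne) (hmem hne)).symm.trans (hline hW hcW)
  rw [← hspan]
  exact ⟨Submodule.subset_span (by simp), Submodule.subset_span (by simp)⟩
end
end

section
/- Let P₁, P₂ be cameras with distinct camera centers p₁, p₂, let v₁, v₂ ∈ ℝ⁴ span ker P₁ and ker P₂ respectively, and let F_P be their fundamental matrix. Consider the linear map Φ from the space of real 3×3 matrices to the space of real quadratic forms on ℝ⁴ given by Φ(F)(x) = xᵀ P₁ᵀ F P₂ x. Then the kernel of Φ is exactly the one-dimensional span of F_P, and the image of Φ is exactly the space of quadratic forms on ℝ⁴ vanishing at both v₁ and v₂ (an 8-dimensional space). -/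
open Matrix

noncomputable section

theorem isUnit_of_rank_eq_card {K n : Type*} [Field K] [Fintype n] [DecidableEq n]
    {A : Matrix n n K} (h : A.rank = Fintype.card n) : IsUnit A := by
  rw [← Matrix.mulVec_surjective_iff_isUnit]
  have : LinearMap.range A.mulVecLin = ⊤ :=
    Submodule.eq_top_of_finrank_eq (by rw [← Matrix.rank, h, Module.finrank_fintype_fun_eq_card])
  exact LinearMap.range_eq_top.mp this

/-- A quadratic form vanishes identically iff its matrix is skew-symmetric. -/
theorem dotProduct_mulVec_self_eq_zero_iff {n : Type*} [Fintype n] (A : Matrix n n ℝ) :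
    (∀ x : n → ℝ, x ⬝ᵥ A.mulVec x = 0) ↔ A + Aᵀ = 0 := by
  classical
  have key (x y : n → ℝ) : x ⬝ᵥ Aᵀ.mulVec y = y ⬝ᵥ A.mulVec x := by
    rw [mulVec_transpose, dotProduct_comm, dotProduct_mulVec]
  constructor
  · intro h
    ext i j
    have h1 := h (Pi.single i 1 + Pi.single j 1)
    have hi := h (Pi.single i 1)
    have hj := h (Pi.single j 1)
    simp only [mulVec_add, add_dotProduct, dotProduct_add, single_one_dotProduct,
      mulVec_single_one, col_apply] at h1 hi hj
    simp only [Matrix.add_apply, transpose_apply, Matrix.zero_apply]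
    linarith
  · intro h x
    have h1 : x ⬝ᵥ (A + Aᵀ).mulVec x = 0 := by simp [h]
    rw [add_mulVec, dotProduct_add, key] at h1
    linarith

/-- The coordinate projection `ℝ⁴ → ℝ³` forgetting the `k`-th coordinate. -/
def dropCoord (k : Fin 4) : Matrix (Fin 3) (Fin 4) ℝ :=
  (1 : Matrix (Fin 4) (Fin 4) ℝ).submatrix k.succAbove id

theorem dropCoord_mulVec (k : Fin 4) (u : Fin 4 → ℝ) (i : Fin 3) :
    (dropCoord k).mulVec u i = u (k.succAbove i) := by
  simp [dropCoord, mulVec, dotProduct, one_apply]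

theorem submatrix_mul_dropCoord {A : Matrix (Fin 3) (Fin 4) ℝ} {k : Fin 4}
    (h : ∀ i, A i k = 0) : A.submatrix id k.succAbove * dropCoord k = A := by
  ext i j
  rcases Fin.eq_self_or_eq_succAbove k j with rfl | ⟨l, rfl⟩
  · simp [mul_apply, dropCoord, one_apply, h]
  · simp [mul_apply, dropCoord, one_apply]

theorem exists_isUnit_mul_dropCoord {A : Matrix (Fin 3) (Fin 4) ℝ} {k : Fin 4}
    (hA : A.rank = 3) (h : ∀ i, A i k = 0) :
    ∃ G : Matrix (Fin 3) (Fin 3) ℝ, IsUnit G ∧ A = G * dropCoord k := by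
  have hG := submatrix_mul_dropCoord h
  refine ⟨_, isUnit_of_rank_eq_card (le_antisymm (rank_le_card_width _) ?_), hG.symm⟩
  calc Fintype.card (Fin 3) = (A.submatrix id k.succAbove * dropCoord k).rank := by
        rw [hG, hA, Fintype.card_fin]
    _ ≤ _ := rank_mul_le_left _ _

/-- Two independent vectors of `ℝ⁴` are the first two columns of an invertible matrix. -/
theorem exists_isUnit_col_eq {v₁ v₂ : Fin 4 → ℝ} (h : LinearIndependent ℝ ![v₁, v₂]) :
    ∃ K : Matrix (Fin 4) (Fin 4) ℝ, IsUnit K ∧ K.col 0 = v₁ ∧ K.col 1 = v₂ := by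
  obtain ⟨a, ha⟩ := exists_linearIndependent_snoc_of_lt_finrank h (by simp)
  obtain ⟨b, hb⟩ := exists_linearIndependent_snoc_of_lt_finrank ha (by simp)
  refine ⟨(of (Fin.snoc (Fin.snoc ![v₁, v₂] a) b : Fin 4 → Fin 4 → ℝ))ᵀ, ?_, rfl, rfl⟩
  exact linearIndependent_cols_iff_isUnit.mp hb

/-- In suitable coordinates, two cameras with distinct centers are the two projections forgetting
the first and the second coordinate. -/
theorem exists_normal_form {P₁ P₂ : Matrix (Fin 3) (Fin 4) ℝ} (h₁ : P₁.rank = 3)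
    (h₂ : P₂.rank = 3) {v₁ v₂ : Fin 4 → ℝ} (hv : LinearIndependent ℝ ![v₁, v₂])
    (hk₁ : P₁.mulVec v₁ = 0) (hk₂ : P₂.mulVec v₂ = 0) :
    ∃ (K : Matrix (Fin 4) (Fin 4) ℝ) (G₁ G₂ : Matrix (Fin 3) (Fin 3) ℝ),
      IsUnit K ∧ IsUnit G₁ ∧ IsUnit G₂ ∧ K.col 0 = v₁ ∧ K.col 1 = v₂ ∧
      P₁ * K = G₁ * dropCoord 0 ∧ P₂ * K = G₂ * dropCoord 1 := by
  obtain ⟨K, hK, hK₁, hK₂⟩ := exists_isUnit_col_eq hv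
  have hKd : IsUnit K.det := (isUnit_iff_isUnit_det K).mp hK
  obtain ⟨G₁, hG₁, e₁⟩ := exists_isUnit_mul_dropCoord (A := P₁ * K) (k := 0)
    (by rw [rank_mul_eq_left_of_isUnit_det _ _ hKd, h₁])
    (fun i => by rw [← hK₁] at hk₁; exact congrFun hk₁ i)
  obtain ⟨G₂, hG₂, e₂⟩ := exists_isUnit_mul_dropCoord (A := P₂ * K) (k := 1)
    (by rw [rank_mul_eq_left_of_isUnit_det _ _ hKd, h₂])
    (fun i => by rw [← hK₂] at hk₂; exact congrFun hk₂ i)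
  exact ⟨K, G₁, G₂, hK, hG₁, hG₂, hK₁, hK₂, e₁, e₂⟩

theorem dropCoord_conj_eq (F : Matrix (Fin 3) (Fin 3) ℝ) :
    (dropCoord 0)ᵀ * F * dropCoord 1 =
      !![0, 0, 0, 0;
         F 0 0, 0, F 0 1, F 0 2;
         F 1 0, 0, F 1 1, F 1 2;
         F 2 0, 0, F 2 1, F 2 2] := by
  ext i j
  fin_cases i <;> fin_cases j <;>
    simp [mul_apply, Fin.sum_univ_three, dropCoord, one_apply, Fin.succAbove]

theorem eq_smul_of_dropCoord_conj_skew {F : Matrix (Fin 3) (Fin 3) ℝ}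
    (h : (dropCoord 0)ᵀ * F * dropCoord 1 + ((dropCoord 0)ᵀ * F * dropCoord 1)ᵀ = 0) :
    F = F 1 2 • !![0, 0, 0; 0, 0, 1; 0, -1, 0] := by
  rw [dropCoord_conj_eq] at h
  have e (i j : Fin 4) := congrFun (congrFun h i) j
  have e01 := e 0 1
  have e02 := e 0 2
  have e03 := e 0 3
  have e12 := e 1 2
  have e13 := e 1 3
  have e22 := e 2 2
  have e23 := e 2 3
  have e33 := e 3 3
  simp at e01 e02 e03 e12 e13 e22 e23 e33
  ext i j
  fin_cases i <;> fin_cases j <;> simp <;> linarith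

theorem exists_sub_dropCoord_conj_skew {S : Matrix (Fin 4) (Fin 4) ℝ} (hS : S.IsSymm)
    (h0 : S 0 0 = 0) (h1 : S 1 1 = 0) :
    ∃ F : Matrix (Fin 3) (Fin 3) ℝ,
      (S - (dropCoord 0)ᵀ * F * dropCoord 1) + (S - (dropCoord 0)ᵀ * F * dropCoord 1)ᵀ = 0 := by
  refine ⟨!![2 * S 0 1, 2 * S 1 2, 2 * S 1 3;
    2 * S 0 2, S 2 2, 2 * S 2 3; 2 * S 0 3, 0, S 3 3], ?_⟩
  rw [dropCoord_conj_eq]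
  have s (i j : Fin 4) : S i j = S j i := hS.apply j i
  ext i j
  fin_cases i <;> fin_cases j <;> simp [h0, h1] <;>
    linarith [s 0 1, s 0 2, s 0 3, s 1 2, s 1 3, s 2 3]

theorem bigM_mulVec (P₁ P₂ : Matrix (Fin 3) (Fin 4) ℝ) (x y : Fin 3 → ℝ) (u : Fin 4 → ℝ)
    (a b : ℝ) :
    (bigM P₁ P₂ x y).mulVec ![u 0, u 1, u 2, u 3, a, b] =
      Fin.append (P₁.mulVec u + a • x) (P₂.mulVec u + b • y) := by
  ext i
  fin_cases i <;>
    simp [bigM, mulVec, dotProduct, Fin.sum_univ_succ, Fin.append, Fin.addCases] <;> ring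

theorem det_bigM_mulVec_self (P₁ P₂ : Matrix (Fin 3) (Fin 4) ℝ) (u : Fin 4 → ℝ) :
    (bigM P₁ P₂ (P₁.mulVec u) (P₂.mulVec u)).det = 0 := by
  rw [← exists_mulVec_eq_zero_iff]
  refine ⟨![u 0, u 1, u 2, u 3, -1, -1], fun h => ?_, ?_⟩
  · simpa using congrFun h 4
  · rw [bigM_mulVec]
    ext i
    refine Fin.addCases (m := 3) (n := 3) (fun j => ?_) (fun j => ?_) i <;>
      simp [-Fin.natAdd_eq_addNat]

theorem dotProduct_conj_mulVec (P₁ P₂ : Matrix (Fin 3) (Fin 4) ℝ) (F : Matrix (Fin 3) (Fin 3) ℝ)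
    (x : Fin 4 → ℝ) :
    x ⬝ᵥ (P₁ᵀ * F * P₂).mulVec x = P₁.mulVec x ⬝ᵥ F.mulVec (P₂.mulVec x) := by
  rw [← mulVec_mulVec, ← mulVec_mulVec, dotProduct_mulVec, vecMul_transpose]

theorem IsFundamental.ne_zero {P₁ P₂ : Matrix (Fin 3) (Fin 4) ℝ} {F : Matrix (Fin 3) (Fin 3) ℝ}
    (hF : IsFundamental P₁ P₂ F) {K : Matrix (Fin 4) (Fin 4) ℝ} {G₁ G₂ : Matrix (Fin 3) (Fin 3) ℝ}
    (hK : IsUnit K) (hG₁ : IsUnit G₁) (hG₂ : IsUnit G₂)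
    (e₁ : P₁ * K = G₁ * dropCoord 0) (e₂ : P₂ * K = G₂ * dropCoord 1) : F ≠ 0 := by
  rintro rfl
  have h := hF (G₁.mulVec (Pi.single 1 1)) (G₂.mulVec (Pi.single 2 1))
  rw [zero_mulVec, dotProduct_zero, eq_comm, ← exists_mulVec_eq_zero_iff] at h
  obtain ⟨w, hw, h⟩ := h
  obtain ⟨u, hu⟩ := mulVec_surjective_iff_isUnit.mpr hK ![w 0, w 1, w 2, w 3]
  have hw' : w = ![K.mulVec u 0, K.mulVec u 1, K.mulVec u 2, K.mulVec u 3, w 4, w 5] := by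
    rw [hu]
    ext i
    fin_cases i <;> rfl
  rw [hw', bigM_mulVec, mulVec_mulVec, mulVec_mulVec, e₁, e₂, ← mulVec_mulVec, ← mulVec_mulVec,
    ← mulVec_smul, ← mulVec_smul, ← mulVec_add, ← mulVec_add] at h
  have h₁ : (dropCoord 0).mulVec u + w 4 • Pi.single 1 1 = 0 := by
    apply mulVec_injective_iff_isUnit.mpr hG₁
    rw [mulVec_zero]
    ext i
    simpa using congrFun h (Fin.castAdd 3 i)
  have h₂ : (dropCoord 1).mulVec u + w 5 • Pi.single 2 1 = 0 := by
    apply mulVec_injective_iff_isUnit.mpr hG₂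
    rw [mulVec_zero]
    ext i
    simpa [-Fin.natAdd_eq_addNat] using congrFun h (Fin.natAdd 3 i)
  have a0 := congrFun h₁ 0
  have a1 := congrFun h₁ 1
  have a2 := congrFun h₁ 2
  have b0 := congrFun h₂ 0
  have b1 := congrFun h₂ 1
  have b2 := congrFun h₂ 2
  simp [dropCoord_mulVec, Fin.succAbove] at a0 a1 a2 b0 b1 b2
  have hu0 : u = 0 := by
    ext i
    fin_cases i <;> simp <;> assumption
  simp only [hu0, Pi.zero_apply, zero_add] at a1 b2
  apply hw
  rw [hw', hu0, a1, b2]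
  ext i
  fin_cases i <;> simp

/-- The quadratic form of `P₁ᵀ F P₂` in the coordinates of `exists_normal_form`. -/
theorem dotProduct_conj_mulVec_normal_form {P₁ P₂ : Matrix (Fin 3) (Fin 4) ℝ}
    {K : Matrix (Fin 4) (Fin 4) ℝ} {G₁ G₂ : Matrix (Fin 3) (Fin 3) ℝ}
    (e₁ : P₁ * K = G₁ * dropCoord 0) (e₂ : P₂ * K = G₂ * dropCoord 1)
    (F : Matrix (Fin 3) (Fin 3) ℝ) (u : Fin 4 → ℝ) :
    K.mulVec u ⬝ᵥ (P₁ᵀ * F * P₂).mulVec (K.mulVec u) =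
      u ⬝ᵥ ((dropCoord 0)ᵀ * (G₁ᵀ * F * G₂) * dropCoord 1).mulVec u := by
  rw [dotProduct_conj_mulVec, dotProduct_conj_mulVec, mulVec_mulVec u P₁, mulVec_mulVec u P₂, e₁,
    e₂, ← mulVec_mulVec, ← mulVec_mulVec, ← mulVec_mulVec, ← mulVec_mulVec,
    dotProduct_mulVec _ G₁ᵀ, vecMul_transpose]

/-- The matrices `F` whose quadratic form `xᵀ P₁ᵀ F P₂ x` vanishes are proportional. -/
theorem exists_eq_smul_of_form_eq_zero {P₁ P₂ : Matrix (Fin 3) (Fin 4) ℝ}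
    {K : Matrix (Fin 4) (Fin 4) ℝ} {G₁ G₂ : Matrix (Fin 3) (Fin 3) ℝ}
    (hG₁ : IsUnit G₁) (hG₂ : IsUnit G₂)
    (e₁ : P₁ * K = G₁ * dropCoord 0) (e₂ : P₂ * K = G₂ * dropCoord 1)
    {F F' : Matrix (Fin 3) (Fin 3) ℝ} (hF' : F' ≠ 0)
    (h : ∀ x : Fin 4 → ℝ, x ⬝ᵥ (P₁ᵀ * F * P₂).mulVec x = 0)
    (h' : ∀ x : Fin 4 → ℝ, x ⬝ᵥ (P₁ᵀ * F' * P₂).mulVec x = 0) :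
    ∃ l : ℝ, F = l • F' := by
  have key {A : Matrix (Fin 3) (Fin 3) ℝ}
      (hA : ∀ x : Fin 4 → ℝ, x ⬝ᵥ (P₁ᵀ * A * P₂).mulVec x = 0) :=
    eq_smul_of_dropCoord_conj_skew ((dotProduct_mulVec_self_eq_zero_iff _).mp fun u =>
      (dotProduct_conj_mulVec_normal_form e₁ e₂ A u).symm.trans (hA _))
  have cancel {A B : Matrix (Fin 3) (Fin 3) ℝ} (hAB : G₁ᵀ * A * G₂ = G₁ᵀ * B * G₂) : A = B :=
    ((isUnit_transpose G₁).mpr hG₁).mul_left_cancel (hG₂.mul_right_cancel hAB)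
  have k := key h
  have k' := key h'
  have hd : (G₁ᵀ * F' * G₂) 1 2 ≠ 0 := by
    intro hd
    rw [hd, zero_smul] at k'
    exact hF' (cancel (by rw [k']; simp))
  refine ⟨(G₁ᵀ * F * G₂) 1 2 / (G₁ᵀ * F' * G₂) 1 2, cancel ?_⟩
  rw [Matrix.mul_smul, Matrix.smul_mul, k']
  conv_lhs => rw [k]
  simp only [Matrix.smul_apply, smul_smul]
  congr 1
  simp
  field_simp

/-- A quadratic form vanishing at both camera centers is of the form `xᵀ P₁ᵀ F P₂ x`. -/
theorem exists_form_eq {P₁ P₂ : Matrix (Fin 3) (Fin 4) ℝ}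
    {K : Matrix (Fin 4) (Fin 4) ℝ} {G₁ G₂ : Matrix (Fin 3) (Fin 3) ℝ}
    (hK : IsUnit K) (hG₁ : IsUnit G₁) (hG₂ : IsUnit G₂)
    (e₁ : P₁ * K = G₁ * dropCoord 0) (e₂ : P₂ * K = G₂ * dropCoord 1)
    {S : Matrix (Fin 4) (Fin 4) ℝ} (hS : S.IsSymm)
    (h0 : K.col 0 ⬝ᵥ S.mulVec (K.col 0) = 0) (h1 : K.col 1 ⬝ᵥ S.mulVec (K.col 1) = 0) :
    ∃ F : Matrix (Fin 3) (Fin 3) ℝ,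
      ∀ x : Fin 4 → ℝ, x ⬝ᵥ S.mulVec x = x ⬝ᵥ (P₁ᵀ * F * P₂).mulVec x := by
  have hT : (Kᵀ * S * K).IsSymm := by
    simp [IsSymm, transpose_mul, hS.eq, Matrix.mul_assoc]
  have hT_form (u : Fin 4 → ℝ) :
      u ⬝ᵥ (Kᵀ * S * K).mulVec u = K.mulVec u ⬝ᵥ S.mulVec (K.mulVec u) := by
    rw [← mulVec_mulVec, ← mulVec_mulVec, dotProduct_mulVec, vecMul_transpose]
  have hdiag (k : Fin 4) : (Kᵀ * S * K) k k = K.col k ⬝ᵥ S.mulVec (K.col k) := by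
    simpa using hT_form (Pi.single k 1)
  obtain ⟨F, hF⟩ := exists_sub_dropCoord_conj_skew hT ((hdiag 0).trans h0) ((hdiag 1).trans h1)
  obtain ⟨H₁, hH₁⟩ := ((isUnit_transpose G₁).mpr hG₁).exists_right_inv
  obtain ⟨H₂, hH₂⟩ := hG₂.exists_left_inv
  refine ⟨H₁ * F * H₂, fun x => ?_⟩
  obtain ⟨u, rfl⟩ := mulVec_surjective_iff_isUnit.mpr hK x
  have hc : G₁ᵀ * (H₁ * F * H₂) * G₂ = F := by
    rw [Matrix.mul_assoc H₁, ← Matrix.mul_assoc, hH₁, Matrix.one_mul, Matrix.mul_assoc, hH₂,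
      Matrix.mul_one]
  have := (dotProduct_mulVec_self_eq_zero_iff _).mpr hF u
  rw [sub_mulVec, dotProduct_sub, sub_eq_zero, hT_form] at this
  rw [dotProduct_conj_mulVec_normal_form e₁ e₂, hc, this]

/-- The linear map sending `F` to (twice) the symmetric matrix of the form `xᵀ P₁ᵀ F P₂ x`. -/
def symmForm (P₁ P₂ : Matrix (Fin 3) (Fin 4) ℝ) :
    Matrix (Fin 3) (Fin 3) ℝ →ₗ[ℝ] Matrix (Fin 4) (Fin 4) ℝ where
  toFun F := P₁ᵀ * F * P₂ + (P₁ᵀ * F * P₂)ᵀ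
  map_add' F F' := by
    simp only [Matrix.mul_add, Matrix.add_mul, transpose_add]
    abel
  map_smul' c F := by simp [Matrix.mul_smul, Matrix.smul_mul]

theorem statement5
    (P₁ P₂ : Matrix (Fin 3) (Fin 4) ℝ)
    (h₁ : P₁.rank = 3) (h₂ : P₂.rank = 3)
    (v₁ v₂ : Fin 4 → ℝ) (hv₁ : v₁ ≠ 0) (hv₂ : v₂ ≠ 0)
    (hk₁ : P₁.mulVec v₁ = 0) (hk₂ : P₂.mulVec v₂ = 0)
    (hdist : ∀ l : ℝ, v₂ ≠ l • v₁)
    (Fp : Matrix (Fin 3) (Fin 3) ℝ) (hFp : IsFundamental P₁ P₂ Fp) :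
    (∀ F : Matrix (Fin 3) (Fin 3) ℝ,
      (∀ x : Fin 4 → ℝ, x ⬝ᵥ (P₁ᵀ * F * P₂).mulVec x = 0) ↔ ∃ l : ℝ, F = l • Fp) ∧
    Fp ≠ 0 ∧
    (∀ S : Matrix (Fin 4) (Fin 4) ℝ, S.IsSymm →
      ((∃ F : Matrix (Fin 3) (Fin 3) ℝ,
          ∀ x : Fin 4 → ℝ, x ⬝ᵥ S.mulVec x = x ⬝ᵥ (P₁ᵀ * F * P₂).mulVec x) ↔
        (v₁ ⬝ᵥ S.mulVec v₁ = 0 ∧ v₂ ⬝ᵥ S.mulVec v₂ = 0))) ∧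
    Module.finrank ℝ
      ↥(Submodule.span ℝ {S : Matrix (Fin 4) (Fin 4) ℝ |
          ∃ F : Matrix (Fin 3) (Fin 3) ℝ, S = P₁ᵀ * F * P₂ + (P₁ᵀ * F * P₂)ᵀ}) = 8 := by
  have hv : LinearIndependent ℝ ![v₁, v₂] :=
    (LinearIndependent.pair_iff' hv₁).mpr fun a h => hdist a h.symm
  obtain ⟨K, G₁, G₂, hK, hG₁, hG₂, hK₁, hK₂, e₁, e₂⟩ := exists_normal_form h₁ h₂ hv hk₁ hk₂
  have hne : Fp ≠ 0 := hFp.ne_zero hK hG₁ hG₂ e₁ e₂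
  have hFp_form (x : Fin 4 → ℝ) : x ⬝ᵥ (P₁ᵀ * Fp * P₂).mulVec x = 0 := by
    rw [dotProduct_conj_mulVec, hFp, det_bigM_mulVec_self]
  have hker (F : Matrix (Fin 3) (Fin 3) ℝ) :
      (∀ x : Fin 4 → ℝ, x ⬝ᵥ (P₁ᵀ * F * P₂).mulVec x = 0) ↔ ∃ l : ℝ, F = l • Fp := by
    refine ⟨fun h => exists_eq_smul_of_form_eq_zero hG₁ hG₂ e₁ e₂ hne h hFp_form, ?_⟩
    rintro ⟨l, rfl⟩ x
    rw [Matrix.mul_smul, Matrix.smul_mul, smul_mulVec, dotProduct_smul, hFp_form, smul_zero]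
  refine ⟨hker, hne, fun S hS => ⟨?_, fun ⟨h0, h1⟩ => ?_⟩, ?_⟩
  · rintro ⟨F, hF⟩
    constructor
    · rw [hF, dotProduct_conj_mulVec, hk₁, zero_dotProduct]
    · rw [hF, dotProduct_conj_mulVec, hk₂, mulVec_zero, dotProduct_zero]
  · subst hK₁ hK₂
    exact exists_form_eq hK hG₁ hG₂ e₁ e₂ hS h0 h1
  · have hset : {S : Matrix (Fin 4) (Fin 4) ℝ |
        ∃ F : Matrix (Fin 3) (Fin 3) ℝ, S = P₁ᵀ * F * P₂ + (P₁ᵀ * F * P₂)ᵀ} =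
          LinearMap.range (symmForm P₁ P₂) := by
      ext S
      exact exists_congr fun F => eq_comm
    have hspan : LinearMap.ker (symmForm P₁ P₂) = Submodule.span ℝ {Fp} := by
      ext F
      rw [Submodule.mem_span_singleton, LinearMap.mem_ker]
      exact (dotProduct_mulVec_self_eq_zero_iff _).symm.trans
        ((hker F).trans (exists_congr fun l => eq_comm))
    rw [hset, Submodule.span_eq]
    have h := LinearMap.finrank_range_add_finrank_ker (symmForm P₁ P₂)
    rw [hspan, finrank_span_singleton hne, Module.finrank_matrix] at h
    simpa using h
end
end

section
/- Let (P₁,P₂,X) be a non-trivially critical configuration with camera centers p₁, p₂. Then there exists a nonzero real symmetric 4×4 matrix S such that Xᵀ S X = 0 for every representative vector X of every point of X ∪ {p₁, p₂}, and such that the quadric surface {x ∈ ℙ³ : xᵀ S x = 0} contains a projective line spanned by two real points. -/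
open Matrix

noncomputable section

/-- The vector of `ℝ⁶` with blocks `w`, `a`, `b`. -/
def blockVec (w : Fin 4 → ℝ) (a b : ℝ) : Fin 6 → ℝ :=
  ![w 0, w 1, w 2, w 3, a, b]

lemma blockVec_surjective (v : Fin 6 → ℝ) : ∃ w a b, blockVec w a b = v :=
  ⟨![v 0, v 1, v 2, v 3], v 4, v 5, by ext i; fin_cases i <;> rfl⟩

lemma bigM_mulVec_blockVec (P Q : Matrix (Fin 3) (Fin 4) ℝ) (x y : Fin 3 → ℝ)
    (w : Fin 4 → ℝ) (a b : ℝ) :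
    (bigM P Q x y).mulVec (blockVec w a b) = 0 ↔
      P.mulVec w + a • x = 0 ∧ Q.mulVec w + b • y = 0 := by
  simp only [funext_iff, mulVec, dotProduct, Fin.sum_univ_six, Fin.sum_univ_four, Pi.add_apply]
  simp [Fin.forall_fin_succ, bigM, blockVec, and_assoc, mul_comm a, mul_comm b]

lemma det_bigM_eq_zero {P Q : Matrix (Fin 3) (Fin 4) ℝ} {x y : Fin 3 → ℝ}
    (w : Fin 4 → ℝ) (a b : ℝ) (h : blockVec w a b ≠ 0)
    (hP : P.mulVec w + a • x = 0) (hQ : Q.mulVec w + b • y = 0) :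
    (bigM P Q x y).det = 0 :=
  Matrix.exists_mulVec_eq_zero_iff.mp ⟨_, h, (bigM_mulVec_blockVec ..).mpr ⟨hP, hQ⟩⟩

lemma bigM_eq_updateCol_left (P Q : Matrix (Fin 3) (Fin 4) ℝ) (x y : Fin 3 → ℝ) :
    bigM P Q x y = (bigM P Q 0 y).updateCol 4 ![x 0, x 1, x 2, 0, 0, 0] := by
  ext i j
  fin_cases i <;> fin_cases j <;> simp [bigM]

lemma bigM_eq_updateCol_right (P Q : Matrix (Fin 3) (Fin 4) ℝ) (x y : Fin 3 → ℝ) :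
    bigM P Q x y = (bigM P Q x 0).updateCol 5 ![0, 0, 0, y 0, y 1, y 2] := by
  ext i j
  fin_cases i <;> fin_cases j <;> simp [bigM]

/-- `det M(x, y)` as a bilinear form in `x` and `y`. -/
def fundForm (P Q : Matrix (Fin 3) (Fin 4) ℝ) :
    (Fin 3 → ℝ) →ₗ[ℝ] (Fin 3 → ℝ) →ₗ[ℝ] ℝ :=
  LinearMap.mk₂ ℝ (fun x y => (bigM P Q x y).det)
    (fun x x' y => by
      rw [bigM_eq_updateCol_left P Q (x + x'), bigM_eq_updateCol_left P Q x,
        bigM_eq_updateCol_left P Q x', ← det_updateCol_add]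
      simp)
    (fun c x y => by
      rw [bigM_eq_updateCol_left P Q (c • x), bigM_eq_updateCol_left P Q x, smul_eq_mul,
        ← det_updateCol_smul]
      simp)
    (fun x y y' => by
      rw [bigM_eq_updateCol_right P Q x (y + y'), bigM_eq_updateCol_right P Q x y,
        bigM_eq_updateCol_right P Q x y', ← det_updateCol_add]
      simp)
    (fun c x y => by
      rw [bigM_eq_updateCol_right P Q x (c • y), bigM_eq_updateCol_right P Q x y, smul_eq_mul,
        ← det_updateCol_smul]
      simp)

lemma exists_isFundamental (P Q : Matrix (Fin 3) (Fin 4) ℝ) : ∃ F, IsFundamental P Q F :=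
  ⟨LinearMap.toMatrix₂' ℝ (fundForm P Q), fun x y => by
    rw [← Matrix.toLinearMap₂'_apply', Matrix.toLinearMap₂'_toMatrix']
    rfl⟩

lemma IsFundamental.dotProduct_mulVec_self {P Q : Matrix (Fin 3) (Fin 4) ℝ}
    {F : Matrix (Fin 3) (Fin 3) ℝ} (hF : IsFundamental P Q F) (w : Fin 4 → ℝ) :
    P.mulVec w ⬝ᵥ F.mulVec (Q.mulVec w) = 0 := by
  rw [hF]
  refine det_bigM_eq_zero w (-1) (-1) (fun h => ?_) (by simp) (by simp)
  simpa [blockVec] using congrFun h 4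

/-- The symmetric matrix of the quadratic form `w ↦ 2 (Pw)ᵀ F (Qw)`. -/
def pullbackForm (P Q : Matrix (Fin 3) (Fin 4) ℝ) (F : Matrix (Fin 3) (Fin 3) ℝ) :
    Matrix (Fin 4) (Fin 4) ℝ :=
  Pᵀ * F * Q + (Pᵀ * F * Q)ᵀ

lemma pullbackForm_isSymm (P Q : Matrix (Fin 3) (Fin 4) ℝ) (F : Matrix (Fin 3) (Fin 3) ℝ) :
    (pullbackForm P Q F).IsSymm := by
  simp [pullbackForm, Matrix.IsSymm, add_comm]

lemma dotProduct_add_transpose_mulVec {R : Type*} [CommRing R] (P Q : Matrix (Fin 3) (Fin 4) R)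
    (F : Matrix (Fin 3) (Fin 3) R) (v w : Fin 4 → R) :
    v ⬝ᵥ (Pᵀ * F * Q + (Pᵀ * F * Q)ᵀ).mulVec w =
      P.mulVec v ⬝ᵥ F.mulVec (Q.mulVec w) + P.mulVec w ⬝ᵥ F.mulVec (Q.mulVec v) := by
  have h (v w : Fin 4 → R) :
      v ⬝ᵥ (Pᵀ * F * Q).mulVec w = P.mulVec v ⬝ᵥ F.mulVec (Q.mulVec w) := by
    rw [Matrix.mul_assoc, ← mulVec_mulVec, dotProduct_mulVec, vecMul_transpose, mulVec_mulVec]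
  rw [add_mulVec, dotProduct_add, h, mulVec_transpose, dotProduct_comm v, ← dotProduct_mulVec, h]

lemma cx_pullbackForm (P Q : Matrix (Fin 3) (Fin 4) ℝ) (F : Matrix (Fin 3) (Fin 3) ℝ) :
    cx (pullbackForm P Q F) =
      (cx P)ᵀ * cx F * cx Q + ((cx P)ᵀ * cx F * cx Q)ᵀ := by
  ext i j
  simp [cx, pullbackForm, Matrix.mul_apply]

lemma dotProduct_cx_pullbackForm (P Q : Matrix (Fin 3) (Fin 4) ℝ)
    (F : Matrix (Fin 3) (Fin 3) ℝ) (z : Fin 4 → ℂ) :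
    z ⬝ᵥ (cx (pullbackForm P Q F)).mulVec z =
      2 * ((cx P).mulVec z ⬝ᵥ (cx F).mulVec ((cx Q).mulVec z)) := by
  rw [cx_pullbackForm, dotProduct_add_transpose_mulVec, two_mul]

lemma IsFundamental.pullbackForm_eq_zero {P Q : Matrix (Fin 3) (Fin 4) ℝ}
    {F : Matrix (Fin 3) (Fin 3) ℝ} (hF : IsFundamental P Q F) : pullbackForm P Q F = 0 := by
  have key (v w : Fin 4 → ℝ) : v ⬝ᵥ (pullbackForm P Q F).mulVec w = 0 := by
    have h := hF.dotProduct_mulVec_self (v + w)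
    simp only [mulVec_add, dotProduct_add, add_dotProduct, hF.dotProduct_mulVec_self] at h
    rw [pullbackForm, dotProduct_add_transpose_mulVec]
    linarith
  ext i j
  simpa using key (Pi.single i 1) (Pi.single j 1)

lemma IsFundamental.dotProduct_cx_mulVec_self {P Q : Matrix (Fin 3) (Fin 4) ℝ}
    {F : Matrix (Fin 3) (Fin 3) ℝ} (hF : IsFundamental P Q F) (z : Fin 4 → ℂ) :
    (cx P).mulVec z ⬝ᵥ (cx F).mulVec ((cx Q).mulVec z) = 0 := by
  have h := dotProduct_cx_pullbackForm P Q F z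
  rw [hF.pullbackForm_eq_zero] at h
  simpa [cx] using h

lemma mulVec_surjective_of_rank_eq {P : Matrix (Fin 3) (Fin 4) ℝ} (h : P.rank = 3) :
    Function.Surjective P.mulVec := by
  have : LinearMap.range P.mulVecLin = ⊤ :=
    Submodule.eq_top_of_finrank_eq (by simpa [Matrix.rank] using h)
  exact LinearMap.range_eq_top.mp this

lemma exists_ker_generator_of_rank_eq {P : Matrix (Fin 3) (Fin 4) ℝ} (h : P.rank = 3) :
    ∃ p : Fin 4 → ℝ, p ≠ 0 ∧ P.mulVec p = 0 ∧
      ∀ w, P.mulVec w = 0 → ∃ c : ℝ, c • p = w := by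
  have hk : Module.finrank ℝ (LinearMap.ker P.mulVecLin) = 1 := by
    have := P.mulVecLin.finrank_range_add_finrank_ker
    simp only [Matrix.rank] at h
    simp only [Module.finrank_fin_fun] at this
    omega
  obtain ⟨⟨p, hp⟩, hp0, hgen⟩ := finrank_eq_one_iff'.mp hk
  refine ⟨p, fun h => hp0 (Subtype.ext h), hp, fun w hw => ?_⟩
  obtain ⟨c, hc⟩ := hgen ⟨w, hw⟩
  exact ⟨c, congrArg Subtype.val hc⟩

lemma exists_smul_of_cx_mulVec_eq_zero {P : Matrix (Fin 3) (Fin 4) ℝ} {p : Fin 4 → ℝ}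
    (hgen : ∀ w, P.mulVec w = 0 → ∃ c : ℝ, c • p = w) {z : Fin 4 → ℂ}
    (hz : (cx P).mulVec z = 0) : ∃ c : ℂ, z = c • fun i => (p i : ℂ) := by
  obtain ⟨a, ha⟩ := hgen (fun i => (z i).re) (by
    ext i
    simpa [cx, mulVec, dotProduct] using congrArg Complex.re (congrFun hz i))
  obtain ⟨b, hb⟩ := hgen (fun i => (z i).im) (by
    ext i
    simpa [cx, mulVec, dotProduct] using congrArg Complex.im (congrFun hz i))
  refine ⟨⟨a, b⟩, ?_⟩
  ext i
  apply Complex.ext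
  · simpa using (congrFun ha i).symm
  · simpa using (congrFun hb i).symm

lemma linearIndependent_of_isCenter_ne {P₁ P₂ : Matrix (Fin 3) (Fin 4) ℝ} {c₁ c₂ : Fin 4 → ℝ}
    (hc₁ : c₁ ≠ 0)
    (hgen₁ : ∀ w, P₁.mulVec w = 0 → ∃ c : ℝ, c • c₁ = w)
    (hgen₂ : ∀ w, P₂.mulVec w = 0 → ∃ c : ℝ, c • c₂ = w)
    {p₁ p₂ : P3} (hp₁ : IsCenter P₁ p₁) (hp₂ : IsCenter P₂ p₂) (hpp : p₁ ≠ p₂) :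
    LinearIndependent ℝ ![c₁, c₂] := by
  rw [LinearIndependent.pair_iff' hc₁]
  intro a ha
  apply hpp
  obtain ⟨s, hs⟩ := exists_smul_of_cx_mulVec_eq_zero hgen₁ hp₁
  obtain ⟨t, ht⟩ := exists_smul_of_cx_mulVec_eq_zero hgen₂ hp₂
  have hs0 : s ≠ 0 := by
    rintro rfl
    exact p₁.rep_nonzero (by simpa using hs)
  rw [← p₁.mk_rep, ← p₂.mk_rep, eq_comm, Projectivization.mk_eq_mk_iff']
  refine ⟨t * a * s⁻¹, ?_⟩
  rw [ht, hs, ← ha]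
  ext i
  simp only [Pi.smul_apply, smul_eq_mul, Complex.ofReal_mul]
  field_simp

lemma exists_basis_extending_pair {c₁ c₂ : Fin 4 → ℝ} (h : LinearIndependent ℝ ![c₁, c₂]) :
    ∃ e f : Fin 4 → ℝ, LinearIndependent ℝ ![c₁, c₂, e, f] := by
  have extend {n : ℕ} (hn : n < 4) (v : Fin n → Fin 4 → ℝ) (hv : LinearIndependent ℝ v) :
      ∃ e, LinearIndependent ℝ (Fin.snoc v e : Fin (n + 1) → Fin 4 → ℝ) :=
    exists_linearIndependent_snoc_of_lt_finrank hv (by simpa using hn)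
  obtain ⟨e, he⟩ := extend (by norm_num) _ h
  obtain ⟨f, hf⟩ := extend (by norm_num) _ he
  refine ⟨e, f, ?_⟩
  convert hf using 1
  ext i
  fin_cases i <;> rfl

lemma IsFundamental.dotProduct_mulVec_ne_zero {P₁ P₂ : Matrix (Fin 3) (Fin 4) ℝ}
    {F : Matrix (Fin 3) (Fin 3) ℝ} (hF : IsFundamental P₁ P₂ F) {c₁ c₂ e f : Fin 4 → ℝ}
    (hgen₁ : ∀ w, P₁.mulVec w = 0 → ∃ c : ℝ, c • c₁ = w)
    (hgen₂ : ∀ w, P₂.mulVec w = 0 → ∃ c : ℝ, c • c₂ = w)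
    (hli : LinearIndependent ℝ ![c₁, c₂, e, f]) :
    P₁.mulVec e ⬝ᵥ F.mulVec (P₂.mulVec f) ≠ 0 := by
  rw [hF]
  intro hdet
  obtain ⟨v, hv, hMv⟩ := Matrix.exists_mulVec_eq_zero_iff.mpr hdet
  obtain ⟨w, a, b, rfl⟩ := blockVec_surjective v
  obtain ⟨h₁, h₂⟩ := (bigM_mulVec_blockVec ..).mp hMv
  obtain ⟨s, hs⟩ := hgen₁ (w + a • e) (by rw [mulVec_add, mulVec_smul, h₁])
  obtain ⟨t, ht⟩ := hgen₂ (w + b • f) (by rw [mulVec_add, mulVec_smul, h₂])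
  have hz := Fintype.linearIndependent_iff.mp hli ![s, -t, -a, b] (by
    simp only [Fin.sum_univ_four, cons_val, neg_smul, hs, ht]
    abel)
  have hs0 : s = 0 := hz 0
  have ha0 : a = 0 := by simpa using hz 2
  have hb0 : b = 0 := hz 3
  subst hs0 ha0 hb0
  have hw : w = 0 := by simpa using hs.symm
  apply hv
  ext i
  fin_cases i <;> simp [blockVec, hw]

/-- A matrix pulling back to an alternating form is determined up to scale, since the form
kills both camera centers. -/
lemma IsFundamental.eq_smul_of_pullbackForm_eq_zero {P₁ P₂ : Matrix (Fin 3) (Fin 4) ℝ}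
    (h₁ : P₁.rank = 3) (h₂ : P₂.rank = 3) {F G : Matrix (Fin 3) (Fin 3) ℝ}
    (hF : IsFundamental P₁ P₂ F) {p₁ p₂ : P3} (hp₁ : IsCenter P₁ p₁) (hp₂ : IsCenter P₂ p₂)
    (hpp : p₁ ≠ p₂) (hG : pullbackForm P₁ P₂ G = 0) : ∃ l : ℝ, G = l • F := by
  obtain ⟨c₁, hc₁, hk₁, hgen₁⟩ := exists_ker_generator_of_rank_eq h₁
  obtain ⟨c₂, -, hk₂, hgen₂⟩ := exists_ker_generator_of_rank_eq h₂
  obtain ⟨e, f, hli⟩ := exists_basis_extending_pair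
    (linearIndependent_of_isCenter_ne hc₁ hgen₁ hgen₂ hp₁ hp₂ hpp)
  have hne := hF.dotProduct_mulVec_ne_zero hgen₁ hgen₂ hli
  set r := P₁.mulVec e ⬝ᵥ F.mulVec (P₂.mulVec f)
  set s := P₁.mulVec e ⬝ᵥ G.mulVec (P₂.mulVec f) with hs
  refine ⟨s / r, ?_⟩
  obtain ⟨D, hD⟩ : ∃ D, D = G - (s / r) • F := ⟨_, rfl⟩
  rw [← sub_eq_zero, ← hD]
  have hDval (v w : Fin 4 → ℝ) : P₁.mulVec v ⬝ᵥ D.mulVec (P₂.mulVec w) =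
      P₁.mulVec v ⬝ᵥ G.mulVec (P₂.mulVec w) -
        s / r * (P₁.mulVec v ⬝ᵥ F.mulVec (P₂.mulVec w)) := by
    rw [hD, sub_mulVec, dotProduct_sub, smul_mulVec, dotProduct_smul, smul_eq_mul]
  have hanti (v w : Fin 4 → ℝ) : P₁.mulVec v ⬝ᵥ D.mulVec (P₂.mulVec w) =
      -(P₁.mulVec w ⬝ᵥ D.mulVec (P₂.mulVec v)) := by
    have hGvw := dotProduct_add_transpose_mulVec P₁ P₂ G v w
    have hFvw := dotProduct_add_transpose_mulVec P₁ P₂ F v w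
    rw [← pullbackForm, hG] at hGvw
    rw [← pullbackForm, hF.pullbackForm_eq_zero] at hFvw
    simp only [zero_mulVec, dotProduct_zero] at hGvw hFvw
    rw [hDval, hDval]
    linear_combination (s / r) * hFvw - hGvw
  have hef : P₁.mulVec e ⬝ᵥ D.mulVec (P₂.mulVec f) = 0 := by
    rw [hDval, ← hs, div_mul_cancel₀ _ hne, sub_self]
  have hfe := hanti f e
  rw [hef, neg_zero] at hfe
  have hself (v : Fin 4 → ℝ) : P₁.mulVec v ⬝ᵥ D.mulVec (P₂.mulVec v) = 0 := by
    linarith [hanti v v]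
  have hl₁ (v : Fin 4 → ℝ) : P₁.mulVec v ⬝ᵥ D.mulVec (P₂.mulVec c₁) = 0 := by
    rw [hanti, hk₁, zero_dotProduct, neg_zero]
  have hr₂ (v : Fin 4 → ℝ) : P₁.mulVec c₂ ⬝ᵥ D.mulVec (P₂.mulVec v) = 0 := by
    rw [hanti, hk₂, mulVec_zero, dotProduct_zero, neg_zero]
  have hspan (v : Fin 4 → ℝ) :
      ∃ a b c d : ℝ, v = a • c₁ + b • c₂ + c • e + d • f := by
    let B := basisOfLinearIndependentOfCardEqFinrank hli (by simp)
    have hB := B.sum_repr v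
    refine ⟨B.repr v 0, B.repr v 1, B.repr v 2, B.repr v 3, ?_⟩
    conv_lhs => rw [← hB]
    simp [Fin.sum_univ_four, B]
  have hzero (v w : Fin 4 → ℝ) : P₁.mulVec v ⬝ᵥ D.mulVec (P₂.mulVec w) = 0 := by
    obtain ⟨a, b, c, d, rfl⟩ := hspan v
    obtain ⟨a', b', c', d', rfl⟩ := hspan w
    simp only [mulVec_add, mulVec_smul, dotProduct_add, add_dotProduct, dotProduct_smul,
      smul_dotProduct, hl₁, hr₂, hself, hef, hfe, hk₁, hk₂, zero_dotProduct,
      smul_zero, add_zero]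
  ext i j
  obtain ⟨v, hv⟩ := mulVec_surjective_of_rank_eq h₁ (Pi.single i 1)
  obtain ⟨w, hw⟩ := mulVec_surjective_of_rank_eq h₂ (Pi.single j 1)
  simpa [hv, hw] using hzero v w

lemma IsFundamental.exists_mulVec_eq_zero {P Q : Matrix (Fin 3) (Fin 4) ℝ}
    {F : Matrix (Fin 3) (Fin 3) ℝ} (hF : IsFundamental P Q F) (hP : P.rank = 3) (hF0 : F ≠ 0) :
    ∃ k, k ≠ 0 ∧ F.mulVec k = 0 := by
  obtain ⟨c, hc, hPc, -⟩ := exists_ker_generator_of_rank_eq hP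
  refine ⟨Q.mulVec c, fun hQc => hF0 ?_, ?_⟩
  · ext i j
    have h := hF (Pi.single i 1) (Pi.single j 1)
    rw [det_bigM_eq_zero c 0 0 (fun h => hc ?_) (by simp [hPc]) (by simp [hQc])] at h
    · simpa using h
    · ext i
      fin_cases i
      exacts [congrFun h 0, congrFun h 1, congrFun h 2, congrFun h 3]
  · ext i
    have h := hF (Pi.single i 1) (Q.mulVec c)
    rw [det_bigM_eq_zero c 0 (-1) (fun h => ?_) (by simp [hPc]) (by simp)] at h
    · simpa using h
    · simpa [blockVec] using congrFun h 5

lemma exists_line_in_pullbackForm {P₁ P₂ : Matrix (Fin 3) (Fin 4) ℝ} (h₂ : P₂.rank = 3)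
    {F : Matrix (Fin 3) (Fin 3) ℝ} {k : Fin 3 → ℝ} (hk : k ≠ 0) (hFk : F.mulVec k = 0) :
    ∃ u v : Fin 4 → ℝ, LinearIndependent ℝ ![u, v] ∧
      ∀ a b : ℝ, (a • u + b • v) ⬝ᵥ (pullbackForm P₁ P₂ F).mulVec (a • u + b • v) = 0 := by
  obtain ⟨u, hu⟩ := mulVec_surjective_of_rank_eq h₂ k
  obtain ⟨c, hc, hPc, -⟩ := exists_ker_generator_of_rank_eq h₂
  refine ⟨c, u, ?_, fun a b => ?_⟩
  · rw [LinearIndependent.pair_iff' hc]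
    rintro t rfl
    exact hk (by rw [← hu, mulVec_smul, hPc, smul_zero])
  · rw [pullbackForm, dotProduct_add_transpose_mulVec, mulVec_add P₂, mulVec_smul, mulVec_smul,
      hPc, hu, smul_zero, zero_add, mulVec_smul, hFk, smul_zero, dotProduct_zero, add_zero]

theorem statement6
    (P₁ P₂ : Matrix (Fin 3) (Fin 4) ℝ)
    (h₁ : P₁.rank = 3) (h₂ : P₂.rank = 3)
    (p₁ p₂ : P3) (hp₁ : IsCenter P₁ p₁) (hp₂ : IsCenter P₂ p₂) (hpp : p₁ ≠ p₂)
    (X : Set P3) (hX : ∀ x ∈ X, ¬ IsCenter P₁ x ∧ ¬ IsCenter P₂ x)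
    (hcrit : IsNontrivCritical 2 ![P₁, P₂] X) :
    ∃ S : Matrix (Fin 4) (Fin 4) ℝ, S ≠ 0 ∧ S.IsSymm ∧
      (∀ x ∈ X, x.rep ⬝ᵥ (cx S).mulVec x.rep = 0) ∧
      p₁.rep ⬝ᵥ (cx S).mulVec p₁.rep = 0 ∧
      p₂.rep ⬝ᵥ (cx S).mulVec p₂.rep = 0 ∧
      ∃ u v : Fin 4 → ℝ, LinearIndependent ℝ ![u, v] ∧
        ∀ a b : ℝ, (a • u + b • v) ⬝ᵥ S.mulVec (a • u + b • v) = 0 := by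
  obtain ⟨Q, Y, ⟨⟨hQ, -, -⟩, hXY, -, -⟩, hfund⟩ := hcrit
  obtain ⟨F, hF⟩ := exists_isFundamental P₁ P₂
  obtain ⟨G, hG⟩ := exists_isFundamental (Q 0) (Q 1)
  have hGF : ∀ l : ℝ, G ≠ l • F := hfund 0 1 (by decide) F G hF hG
  obtain ⟨k, hk, hGk⟩ := hG.exists_mulVec_eq_zero (hQ 0) (by simpa using hGF 0)
  refine ⟨pullbackForm P₁ P₂ G, fun h => ?_, pullbackForm_isSymm .., fun x hx => ?_, ?_, ?_,
    exists_line_in_pullbackForm h₂ hk hGk⟩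
  · obtain ⟨l, hl⟩ := hF.eq_smul_of_pullbackForm_eq_zero h₁ h₂ hp₁ hp₂ hpp h
    exact hGF l hl
  · obtain ⟨y, -, hy⟩ := hXY x hx
    obtain ⟨a, -, ha⟩ := hy 0
    obtain ⟨b, -, hb⟩ := hy 1
    simp only [cons_val_zero, cons_val_one] at ha hb
    rw [dotProduct_cx_pullbackForm, ha, hb, mulVec_smul, smul_dotProduct, dotProduct_smul,
      hG.dotProduct_cx_mulVec_self, smul_zero, smul_zero, mul_zero]
  · rw [dotProduct_cx_pullbackForm, hp₁, zero_dotProduct, mul_zero]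
  · rw [dotProduct_cx_pullbackForm, hp₂, mulVec_zero, dotProduct_zero, mul_zero]
end
end

section
/- Let P₁, P₂ be cameras with distinct camera centers and fundamental matrix F_P, and let X be a nonempty set of points of ℙ³, none a camera center. Suppose there exists a real 3×3 matrix F of rank 2 that is not a real scalar multiple of F_P, such that for every x ∈ X with representative vector ξ ∈ ℂ⁴ one has ξᵀ P₁ᵀ F P₂ ξ = 0, and moreover (P₁ξ)ᵀ F ≠ 0 and F (P₂ξ) ≠ 0. Then (P₁,P₂,X) is a non-trivially critical configuration. -/
open Matrix

noncomputable section

/-- The camera `[I | 0]`. -/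
def standardCamera (R : Type*) [CommRing R] : Matrix (Fin 3) (Fin 4) R :=
  !![1, 0, 0, 0; 0, 1, 0, 0; 0, 0, 1, 0]

/-- The camera `[[t]ₓ Fᵀ | t]`. If `t` spans the right kernel of a matrix `F` of rank 2, then
together with `[I | 0]` it forms a pair whose fundamental matrix is proportional to `F`. -/
def companionCamera {R : Type*} [CommRing R] (F : Matrix (Fin 3) (Fin 3) R) (t : Fin 3 → R) :
    Matrix (Fin 3) (Fin 4) R :=
  Matrix.of fun i j => ![(t ⨯₃ F 0) i, (t ⨯₃ F 1) i, (t ⨯₃ F 2) i, t i] j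

lemma cx_standardCamera : cx (standardCamera ℝ) = standardCamera ℂ := by
  ext i j
  fin_cases i <;> fin_cases j <;> simp [cx, standardCamera]

lemma cx_companionCamera (F : Matrix (Fin 3) (Fin 3) ℝ) (t : Fin 3 → ℝ) :
    cx (companionCamera F t) = companionCamera (cx F) (fun i => (t i : ℂ)) := by
  ext i j
  fin_cases i <;> fin_cases j <;> simp [cx, companionCamera, cross_apply]

lemma standardCamera_mulVec {R : Type*} [CommRing R] (v : Fin 4 → R) :
    standardCamera R *ᵥ v = ![v 0, v 1, v 2] := by
  ext i
  fin_cases i <;> simp [standardCamera, mulVec, dotProduct, Fin.sum_univ_succ]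

lemma companionCamera_mulVec {R : Type*} [CommRing R] (F : Matrix (Fin 3) (Fin 3) R)
    (t : Fin 3 → R) (p : Fin 3 → R) (s : R) :
    companionCamera F t *ᵥ ![p 0, p 1, p 2, s] = t ⨯₃ (p ᵥ* F) + s • t := by
  ext i
  fin_cases i <;>
    simp [companionCamera, mulVec, vecMul, dotProduct, Fin.sum_univ_succ, cross_apply] <;> ring

lemma exists_cross_eq_smul {K : Type*} [Field K] {u a b : Fin 3 → K} (hu : u ≠ 0)
    (ha : u ⬝ᵥ a = 0) (hb : u ⬝ᵥ b = 0) : ∃ c : K, a ⨯₃ b = c • u := by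
  obtain ⟨i, hi⟩ := Function.ne_iff.mp hu
  refine ⟨(a ⨯₃ b) i / u i, ?_⟩
  have hi' : u i ≠ 0 := hi
  have key : u ⨯₃ (a ⨯₃ b) = 0 := by
    rw [cross_cross_eq_smul_sub_smul', dotProduct_comm a u, ha, hb, zero_smul, zero_smul, sub_zero]
  have k0 := congrFun key 0
  have k1 := congrFun key 1
  have k2 := congrFun key 2
  simp only [cross_apply u] at k0 k1 k2
  simp at k0 k1 k2
  ext j
  simp only [Pi.smul_apply, smul_eq_mul]
  rw [div_mul_eq_mul_div, eq_div_iff hi']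
  fin_cases i <;> fin_cases j <;> simp only [Fin.zero_eta, Fin.mk_one, Fin.reduceFinMk] <;>
    grind

lemma cross_cross_self_left {R : Type*} [CommRing R] (t q : Fin 3 → R) :
    t ⨯₃ (t ⨯₃ q) = (t ⬝ᵥ q) • t - (t ⬝ᵥ t) • q := by
  ext i
  fin_cases i <;> simp [cross_apply, dotProduct, Fin.sum_univ_succ] <;> ring

/-- A pair of image points satisfying the epipolar constraint of `F`, and avoiding the epipoles,
is the image of a point under the cameras `[I | 0]` and `[[t]ₓ Fᵀ | t]`. -/
lemma exists_companionCamera_mulVec_eq_smul {K : Type*} [Field K]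
    {F : Matrix (Fin 3) (Fin 3) K} {t p q : Fin 3 → K} (ht : t ⬝ᵥ t ≠ 0) (hFt : F *ᵥ t = 0)
    (hpq : p ⬝ᵥ F *ᵥ q = 0) (hp : p ᵥ* F ≠ 0) (hq : F *ᵥ q ≠ 0) :
    ∃ s c : K, c ≠ 0 ∧ companionCamera F t *ᵥ ![p 0, p 1, p 2, s] = c • q := by
  have hut : (p ᵥ* F) ⬝ᵥ t = 0 := by rw [← dotProduct_mulVec, hFt, dotProduct_zero]
  have huq : (p ᵥ* F) ⬝ᵥ q = 0 := by rw [← dotProduct_mulVec, hpq]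
  obtain ⟨c, hc⟩ := exists_cross_eq_smul hp hut huq
  have hdec := cross_cross_self_left t q
  rw [hc, map_smul] at hdec
  have hc0 : c ≠ 0 := by
    rintro rfl
    rw [zero_smul, eq_comm, sub_eq_zero] at hdec
    have := congrArg (F *ᵥ ·) hdec
    simp only [mulVec_smul, hFt, smul_zero] at this
    exact (smul_ne_zero ht hq) this.symm
  refine ⟨-(t ⬝ᵥ q) / c, -(t ⬝ᵥ t) / c, div_ne_zero (neg_ne_zero.mpr ht) hc0, ?_⟩
  rw [companionCamera_mulVec]
  apply smul_right_injective _ hc0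
  simp only [smul_add, hdec, smul_smul, mul_div_cancel₀ _ hc0]
  module

lemma det_bigM_standard_companion (F : Matrix (Fin 3) (Fin 3) ℝ) (t x y : Fin 3 → ℝ)
    (hFt : F *ᵥ t = 0) :
    (bigM (standardCamera ℝ) (companionCamera F t) x y).det =
      (t ⬝ᵥ t) * (x ⬝ᵥ F *ᵥ y) := by
  let A : Matrix (Fin 3) (Fin 3) ℝ :=
    Matrix.of fun i j => ![(t ⨯₃ F 0) i, (t ⨯₃ F 1) i, (t ⨯₃ F 2) i] j
  have h : bigM (standardCamera ℝ) (companionCamera F t) x y =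
      Matrix.reindex (finSumFinEquiv (m := 3) (n := 3)) (finSumFinEquiv (m := 3) (n := 3))
        (fromBlocks 1 (Matrix.of fun i => ![0, x i, 0]) A (Matrix.of fun i => ![t i, 0, y i])) := by
    ext i j
    obtain ⟨i, rfl⟩ := (finSumFinEquiv (m := 3) (n := 3)).surjective i
    obtain ⟨j, rfl⟩ := (finSumFinEquiv (m := 3) (n := 3)).surjective j
    rw [reindex_apply, submatrix_apply, Equiv.symm_apply_apply, Equiv.symm_apply_apply]
    rcases i with i | i <;> rcases j with j | j <;> fin_cases i <;> fin_cases j <;> rfl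
  have hu : t ⬝ᵥ (x ᵥ* F) = 0 := by
    rw [dotProduct_comm, ← dotProduct_mulVec, hFt, dotProduct_zero]
  have hdet : (bigM (standardCamera ℝ) (companionCamera F t) x y).det =
      -(t ⨯₃ (t ⨯₃ (x ᵥ* F))) ⬝ᵥ y := by
    rw [h, det_reindex_self, det_fromBlocks_one₁₁, det_fin_three]
    simp [A, mul_apply, vecMul, dotProduct, Fin.sum_univ_succ, cross_apply]
    ring
  rw [hdet, cross_cross_self_left, hu, zero_smul, zero_sub, neg_neg, smul_dotProduct,
    ← dotProduct_mulVec, smul_eq_mul]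

lemma det_bigM_mul (Q₁ Q₂ : Matrix (Fin 3) (Fin 4) ℝ) (H : Matrix (Fin 4) (Fin 4) ℝ)
    (x y : Fin 3 → ℝ) :
    (bigM (Q₁ * H) (Q₂ * H) x y).det = H.det * (bigM Q₁ Q₂ x y).det := by
  have h : bigM (Q₁ * H) (Q₂ * H) x y = bigM Q₁ Q₂ x y *
      Matrix.reindex finSumFinEquiv finSumFinEquiv
        (fromBlocks H 0 0 (1 : Matrix (Fin 2) (Fin 2) ℝ)) := by
    ext i j
    obtain ⟨j, rfl⟩ := (finSumFinEquiv (m := 4) (n := 2)).surjective j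
    rw [mul_apply, ← (finSumFinEquiv (m := 4) (n := 2)).sum_comp, Fintype.sum_sum_type]
    rcases j with j | j
    · have hlt (k : Fin 4) : (finSumFinEquiv (m := 4) (n := 2) (Sum.inl k)).val < 4 := k.isLt
      by_cases hi : i.val < 3 <;> simp [bigM, mul_apply, hi, hlt] <;> rfl
    · have hge (k : Fin 2) : ¬ (finSumFinEquiv (m := 4) (n := 2) (Sum.inr k)).val < 4 :=
        not_lt.mpr (Nat.le_add_right 4 k)
      simp [bigM, one_apply, hge]
  rw [h, det_mul, det_reindex_self, det_fromBlocks_zero₂₁, det_one, mul_one, mul_comm]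

lemma det_bigM_smul (Q₁ Q₂ : Matrix (Fin 3) (Fin 4) ℝ) (a b : ℝ) (ha : a ≠ 0) (hb : b ≠ 0)
    (x y : Fin 3 → ℝ) :
    (bigM (a • Q₁) (b • Q₂) x y).det = a ^ 2 * b ^ 2 * (bigM Q₁ Q₂ x y).det := by
  have h : bigM (a • Q₁) (b • Q₂) x y * diagonal ![1, 1, 1, 1, a, b] =
      diagonal ![a, a, a, b, b, b] * bigM Q₁ Q₂ x y := by
    ext i j
    rw [mul_diagonal, diagonal_mul]
    fin_cases i <;> fin_cases j <;> simp [bigM, mul_comm]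
  have h' := congrArg det h
  simp only [det_mul, det_diagonal, Fin.prod_univ_succ] at h'
  simp at h'
  apply mul_right_cancel₀ (mul_ne_zero ha hb)
  rw [h']
  ring

lemma exists_ne_zero_mulVec_eq_zero_of_rank_lt {K : Type*} [Field K] {n : ℕ}
    {F : Matrix (Fin n) (Fin n) K} (h : F.rank < n) : ∃ t ≠ 0, F *ᵥ t = 0 := by
  rw [Matrix.exists_mulVec_eq_zero_iff]
  by_contra hd
  have := rank_of_isUnit F ((isUnit_iff_isUnit_det F).mpr (isUnit_iff_ne_zero.mpr hd))
  simp [this] at h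

lemma rank_eq_three_of_vecMul {Q : Matrix (Fin 3) (Fin 4) ℝ}
    (h : ∀ v, v ᵥ* Q = 0 → v = 0) : Q.rank = 3 := by
  have : LinearIndependent ℝ Q.row := by
    rw [← vecMul_injective_iff]
    exact (injective_iff_map_eq_zero Q.vecMulLinear).mpr h
  simpa using this.rank_matrix

lemma rank_standardCamera : (standardCamera ℝ).rank = 3 := by
  refine rank_eq_three_of_vecMul fun v hv => ?_
  have k0 := congrFun hv 0
  have k1 := congrFun hv 1
  have k2 := congrFun hv 2
  simp [standardCamera, vecMul, dotProduct, Fin.sum_univ_succ] at k0 k1 k2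
  ext i
  fin_cases i <;> assumption

lemma rank_companionCamera {F : Matrix (Fin 3) (Fin 3) ℝ} {t : Fin 3 → ℝ} (hF : F.rank = 2)
    (ht : t ≠ 0) (hFt : F *ᵥ t = 0) : (companionCamera F t).rank = 3 := by
  have htt : t ⬝ᵥ t ≠ 0 := by simpa using ht
  refine rank_eq_three_of_vecMul fun v hv => ?_
  have hvt : t ⬝ᵥ v = 0 := by
    have := congrFun hv 3
    rw [dotProduct_comm]
    exact this
  have hF' : F *ᵥ (t ⨯₃ v) = 0 := by
    have k0 := congrFun hv 0
    have k1 := congrFun hv 1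
    have k2 := congrFun hv 2
    simp [companionCamera, vecMul, dotProduct, Fin.sum_univ_succ, cross_apply] at k0 k1 k2
    ext i
    fin_cases i <;> simp [mulVec, dotProduct, Fin.sum_univ_succ, cross_apply] <;> linarith
  have hker : Module.finrank ℝ (LinearMap.ker F.mulVecLin) = 1 := by
    have h := F.mulVecLin.finrank_range_add_finrank_ker
    rw [← Matrix.rank, hF] at h
    simp at h
    omega
  obtain ⟨c, hc⟩ := (finrank_eq_one_iff_of_nonzero' (⟨t, hFt⟩ : LinearMap.ker F.mulVecLin)
    (by simpa [Subtype.ext_iff] using ht)).mp hker ⟨t ⨯₃ v, hF'⟩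
  have hc' : c • t = t ⨯₃ v := congrArg Subtype.val hc
  have hzero : c = 0 := by
    have := congrArg (t ⬝ᵥ ·) hc'
    simpa [dot_self_cross, htt] using this
  have hdec := cross_cross_self_left t v
  rw [← hc', hzero, hvt] at hdec
  simpa [htt, ht] using hdec

lemma IsFundamental.eq_smul_of_det_eq {P₁ P₂ : Matrix (Fin 3) (Fin 4) ℝ} {F G : Matrix (Fin 3) (Fin 3) ℝ}
    {c : ℝ} (hF : IsFundamental P₁ P₂ F)
    (hG : ∀ x y, (bigM P₁ P₂ x y).det = c * (x ⬝ᵥ G *ᵥ y)) : F = c • G := by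
  ext i j
  have := (hF (Pi.single i 1) (Pi.single j 1)).trans (hG _ _)
  simpa using this

theorem statement7
    (P₁ P₂ : Matrix (Fin 3) (Fin 4) ℝ)
    (h₁ : P₁.rank = 3) (h₂ : P₂.rank = 3)
    (hdist : ∀ z : P3, IsCenter P₁ z → ¬ IsCenter P₂ z)
    (Fp : Matrix (Fin 3) (Fin 3) ℝ) (hFp : IsFundamental P₁ P₂ Fp)
    (X : Set P3) (hne : X.Nonempty)
    (hXc : ∀ x ∈ X, ¬ IsCenter P₁ x ∧ ¬ IsCenter P₂ x)
    (F : Matrix (Fin 3) (Fin 3) ℝ) (hFrank : F.rank = 2)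
    (hFnot : ∀ l : ℝ, F ≠ l • Fp)
    (hvan : ∀ x ∈ X, x.rep ⬝ᵥ (((cx P₁)ᵀ * cx F * cx P₂).mulVec x.rep) = 0)
    (hleft : ∀ x ∈ X, Matrix.vecMul ((cx P₁).mulVec x.rep) (cx F) ≠ 0)
    (hright : ∀ x ∈ X, (cx F).mulVec ((cx P₂).mulVec x.rep) ≠ 0) :
    IsNontrivCritical 2 ![P₁, P₂] X := by
  obtain ⟨t, ht, hFt⟩ := exists_ne_zero_mulVec_eq_zero_of_rank_lt (F := F) (by omega)
  have htt : t ⬝ᵥ t ≠ 0 := by simpa using ht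
  set Q := companionCamera F t with hQ
  have hdet := fun x y => det_bigM_standard_companion F t x y hFt
  have himage : ∀ x ∈ X, ∃ y, SameImage P₁ (standardCamera ℝ) x y ∧ SameImage P₂ Q x y := by
    intro x hx
    set p := cx P₁ *ᵥ x.rep
    set q := cx P₂ *ᵥ x.rep
    have htt' : (fun i => (t i : ℂ)) ⬝ᵥ (fun i => (t i : ℂ)) ≠ 0 := by
      have : (fun i => (t i : ℂ)) ⬝ᵥ (fun i => (t i : ℂ)) = ((t ⬝ᵥ t : ℝ) : ℂ) := by
        simp [dotProduct]
      rw [this]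
      exact_mod_cast htt
    have hFt' : cx F *ᵥ (fun i => (t i : ℂ)) = 0 := by
      ext i
      have := congrArg (fun r : ℝ => (r : ℂ)) (congrFun hFt i)
      simpa [mulVec, dotProduct, cx] using this
    have hpq : p ⬝ᵥ cx F *ᵥ q = 0 := by
      rw [← hvan x hx, ← mulVec_mulVec, ← mulVec_mulVec, dotProduct_mulVec x.rep,
        vecMul_transpose]
    obtain ⟨s, c, hc, hs⟩ := exists_companionCamera_mulVec_eq_smul htt' hFt' hpq
      (hleft x hx) (hright x hx)
    have hpv : standardCamera ℂ *ᵥ ![p 0, p 1, p 2, s] = p := by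
      rw [standardCamera_mulVec]
      ext i
      fin_cases i <;> rfl
    have hv : ![p 0, p 1, p 2, s] ≠ 0 := by
      intro h
      rw [h, mulVec_zero] at hpv
      exact (hXc x hx).1 hpv.symm
    obtain ⟨a, ha⟩ := Projectivization.exists_smul_eq_mk_rep ℂ _ hv
    have ha' : (a : ℂ) • ![p 0, p 1, p 2, s] = (Projectivization.mk ℂ _ hv).rep := ha
    refine ⟨Projectivization.mk ℂ _ hv, ⟨(a : ℂ)⁻¹, inv_ne_zero a.ne_zero, ?_⟩,
      ⟨((a : ℂ) * c)⁻¹, inv_ne_zero (mul_ne_zero a.ne_zero hc), ?_⟩⟩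
    · rw [← ha', cx_standardCamera, mulVec_smul, hpv, smul_smul, inv_mul_cancel₀ a.ne_zero,
        one_smul]
    · rw [← ha', hQ, cx_companionCamera, mulVec_smul, hs, smul_smul _ c, smul_smul,
        inv_mul_cancel₀ (mul_ne_zero a.ne_zero hc), one_smul]
  refine ⟨![standardCamera ℝ, Q],
    {y | ∃ x ∈ X, SameImage P₁ (standardCamera ℝ) x y ∧ SameImage P₂ Q x y},
    ⟨⟨?_, ?_, ?_⟩, ?_, ?_, ?_⟩, ?_⟩
  · simpa [Fin.forall_fin_two] using ⟨rank_standardCamera, rank_companionCamera hFrank ht hFt⟩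
  · have hcenter : ∀ z : P3, IsCenter (standardCamera ℝ) z → ¬ IsCenter Q z := by
      intro z hz hz'
      rw [IsCenter, cx_standardCamera, standardCamera_mulVec] at hz
      have k0 : z.rep 0 = 0 := congrFun hz 0
      have k1 : z.rep 1 = 0 := congrFun hz 1
      have k2 : z.rep 2 = 0 := congrFun hz 2
      have hrep : z.rep = ![(0 : Fin 3 → ℂ) 0, (0 : Fin 3 → ℂ) 1, (0 : Fin 3 → ℂ) 2, z.rep 3] := by
        ext i
        fin_cases i <;> simp [k0, k1, k2]
      rw [IsCenter, hQ, cx_companionCamera, hrep, companionCamera_mulVec, zero_vecMul, map_zero,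
        zero_add, smul_eq_zero] at hz'
      rcases hz' with h3 | h
      · exact z.rep_nonzero (by rw [hrep, h3]; ext i; fin_cases i <;> rfl)
      · exact ht (funext fun i => by simpa using congrFun h i)
    simp only [Fin.forall_fin_two]
    simpa using ⟨hcenter, fun z h h' => hcenter z h' h⟩
  · rintro y ⟨x, hx, ⟨c, -, h⟩, ⟨d, -, h'⟩⟩
    simp only [Fin.forall_fin_two]
    refine ⟨fun hy => (hXc x hx).1 ?_, fun hy => (hXc x hx).2 ?_⟩
    · exact h.trans (smul_eq_zero_of_right _ hy)
    · exact h'.trans (smul_eq_zero_of_right _ hy)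
  · intro x hx
    obtain ⟨y, hy⟩ := himage x hx
    exact ⟨y, ⟨x, hx, hy⟩, by simpa [Fin.forall_fin_two] using hy⟩
  · rintro y ⟨x, hx, hy⟩
    exact ⟨x, hx, by simpa [Fin.forall_fin_two] using hy⟩
  · rintro ⟨H, hH, -, -, hcam⟩
    obtain ⟨a, ha, hPa⟩ := hcam 0
    obtain ⟨b, hb, hPb⟩ := hcam 1
    have hHd : IsUnit H.det := (isUnit_iff_isUnit_det H).mp hH
    have e₁ : P₁ = (a • standardCamera ℝ) * H := by
      rw [← nonsing_inv_mul_cancel_right H P₁ hHd]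
      exact congrArg (· * H) hPa
    have e₂ : P₂ = (b • Q) * H := by
      rw [← nonsing_inv_mul_cancel_right H P₂ hHd]
      exact congrArg (· * H) hPb
    have hprop := IsFundamental.eq_smul_of_det_eq (c := H.det * (a ^ 2 * b ^ 2 * (t ⬝ᵥ t))) (G := F) hFp
      fun x y => by
        rw [e₁, e₂, det_bigM_mul, det_bigM_smul _ _ _ _ ha hb, hdet]
        ring
    have hk : H.det * (a ^ 2 * b ^ 2 * (t ⬝ᵥ t)) ≠ 0 := by
      simp [ha, hb, ht, hHd.ne_zero]
    exact hFnot _ ((inv_smul_eq_iff₀ hk).mpr hprop).symm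
  · intro i j hij FP FQ hFP hFQ l hl
    obtain ⟨rfl, rfl⟩ : i = 0 ∧ j = 1 := by omega
    have hFPeq : FP = (1 : ℝ) • Fp :=
      IsFundamental.eq_smul_of_det_eq hFP fun x y => by rw [one_mul, hFp]; rfl
    have hFQeq : FQ = (t ⬝ᵥ t) • F := IsFundamental.eq_smul_of_det_eq hFQ hdet
    rw [hFPeq, hFQeq, one_smul] at hl
    apply hFnot ((t ⬝ᵥ t)⁻¹ * l)
    rw [mul_smul, ← hl, smul_smul, inv_mul_cancel₀ htt, one_smul]
end
end

section
/- Let P₁,P₂,P₃ and Q₁,Q₂,Q₃ be cameras, each triple with pairwise distinct camera centers, and let x ∈ ℙ³ be a point that is not a camera center of any Pᵢ, with representative ξ ∈ ℂ⁴. For each i let Lᵢ = {z ∈ ℂ⁴ : Qᵢz ∈ ℂ·(Pᵢξ)}, a two-dimensional linear subspace of ℂ⁴. If (Pᵢξ)ᵀ F_Q^{ij} (Pⱼξ) = 0 for every pair i < j, where F_Q^{ij} is the fundamental matrix of (Qᵢ,Qⱼ), then either L₁ ∩ L₂ ∩ L₃ ≠ {0} (the three projective lines ℙ(Lᵢ)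 have a common point) or dim(L₁ + L₂ + L₃) ≤ 3 (the three projective lines lie in a common plane). -/
open Matrix

noncomputable section

/-- The 6×6 matrix with rows `(A | x | 0)` and `(B | 0 | y)` over the complex numbers. -/
def complexBigM (A B : Matrix (Fin 3) (Fin 4) ℂ) (x y : Fin 3 → ℂ) :
    Matrix (Fin 6) (Fin 6) ℂ :=
  Matrix.of fun i j =>
    if hi : (i : ℕ) < 3 then
      if hj : (j : ℕ) < 4 then A ⟨(i : ℕ), hi⟩ ⟨(j : ℕ), hj⟩
      else if (j : ℕ) = 4 then x ⟨(i : ℕ), hi⟩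
      else 0
    else
      if hj : (j : ℕ) < 4 then
        B ⟨(i : ℕ) - 3, by have := i.isLt; omega⟩ ⟨(j : ℕ), hj⟩
      else if (j : ℕ) = 4 then 0
      else y ⟨(i : ℕ) - 3, by have := i.isLt; omega⟩

lemma complexBigM_eq_updateCol_left (A B : Matrix (Fin 3) (Fin 4) ℂ) (x y : Fin 3 → ℂ) :
    complexBigM A B x y = (complexBigM A B 0 y).updateCol 4
      (fun i => if hi : (i : ℕ) < 3 then x ⟨i, hi⟩ else 0) := by
  ext i j
  fin_cases i <;> fin_cases j <;> simp [complexBigM]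

lemma complexBigM_eq_updateCol_right (A B : Matrix (Fin 3) (Fin 4) ℂ) (x y : Fin 3 → ℂ) :
    complexBigM A B x y = (complexBigM A B x 0).updateCol 5
      (fun i => if hi : (i : ℕ) < 3 then 0 else y ⟨(i : ℕ) - 3, by have := i.isLt; omega⟩) := by
  ext i j
  fin_cases i <;> fin_cases j <;> simp [complexBigM]

lemma det_complexBigM_add_smul_left (A B : Matrix (Fin 3) (Fin 4) ℂ) (c : ℂ)
    (x x' y : Fin 3 → ℂ) :
    (complexBigM A B (x + c • x') y).det =
      (complexBigM A B x y).det + c * (complexBigM A B x' y).det := by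
  rw [complexBigM_eq_updateCol_left A B (x + c • x') y, complexBigM_eq_updateCol_left A B x y,
    complexBigM_eq_updateCol_left A B x' y, ← Matrix.det_updateCol_smul,
    ← Matrix.det_updateCol_add]
  congr 2
  ext i
  by_cases hi : (i : ℕ) < 3 <;> simp [hi]

lemma det_complexBigM_add_smul_right (A B : Matrix (Fin 3) (Fin 4) ℂ) (c : ℂ)
    (x y y' : Fin 3 → ℂ) :
    (complexBigM A B x (y + c • y')).det =
      (complexBigM A B x y).det + c * (complexBigM A B x y').det := by
  rw [complexBigM_eq_updateCol_right A B x (y + c • y'), complexBigM_eq_updateCol_right A B x y,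
    complexBigM_eq_updateCol_right A B x y', ← Matrix.det_updateCol_smul,
    ← Matrix.det_updateCol_add]
  congr 2
  ext i
  by_cases hi : (i : ℕ) < 3 <;> simp [hi]

/-- The complexified fundamental matrix computes the complex determinant at real points. -/
lemma IsFundamental.dotProduct_ofReal {P₁ P₂ : Matrix (Fin 3) (Fin 4) ℝ}
    {F : Matrix (Fin 3) (Fin 3) ℝ} (hF : IsFundamental P₁ P₂ F) (x y : Fin 3 → ℝ) :
    (fun i => (x i : ℂ)) ⬝ᵥ (cx F).mulVec (fun i => (y i : ℂ)) =
      (complexBigM (cx P₁) (cx P₂) (fun i => (x i : ℂ)) (fun i => (y i : ℂ))).det := by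
  have hM : complexBigM (cx P₁) (cx P₂) (fun i => (x i : ℂ)) (fun i => (y i : ℂ)) =
      Complex.ofRealHom.mapMatrix (bigM P₁ P₂ x y) := by
    ext i j
    simp only [complexBigM, bigM, cx, RingHom.mapMatrix_apply, Matrix.map_apply, Matrix.of_apply]
    split_ifs <;> simp
  rw [hM, ← RingHom.map_det, ← hF x y]
  simp [dotProduct, Matrix.mulVec, cx]

lemma exists_eq_ofReal_add_I_smul (u : Fin 3 → ℂ) : ∃ a b : Fin 3 → ℝ,
    u = (fun i => (a i : ℂ)) + Complex.I • (fun i => (b i : ℂ)) :=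
  ⟨fun i => (u i).re, fun i => (u i).im, by
    ext i
    simp [mul_comm Complex.I, Complex.re_add_im]⟩

lemma IsFundamental.dotProduct_complex {P₁ P₂ : Matrix (Fin 3) (Fin 4) ℝ}
    {F : Matrix (Fin 3) (Fin 3) ℝ} (hF : IsFundamental P₁ P₂ F) (u v : Fin 3 → ℂ) :
    u ⬝ᵥ (cx F).mulVec v = (complexBigM (cx P₁) (cx P₂) u v).det := by
  obtain ⟨a, b, rfl⟩ := exists_eq_ofReal_add_I_smul u
  obtain ⟨c, d, rfl⟩ := exists_eq_ofReal_add_I_smul v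
  simp only [det_complexBigM_add_smul_left, det_complexBigM_add_smul_right,
    ← hF.dotProduct_ofReal, Matrix.mulVec_add, Matrix.mulVec_smul, add_dotProduct,
    dotProduct_add, smul_dotProduct, dotProduct_smul, smul_eq_mul]

/-- If the complex determinant vanishes, the back-projected lines of `u` and `v` meet. -/
lemma exists_ne_zero_of_det_complexBigM_eq_zero {A B : Matrix (Fin 3) (Fin 4) ℂ}
    {u v : Fin 3 → ℂ} (hu : u ≠ 0) (hv : v ≠ 0) (h : (complexBigM A B u v).det = 0) :
    ∃ z ≠ 0, A.mulVec z ∈ Submodule.span ℂ {u} ∧ B.mulVec z ∈ Submodule.span ℂ {v} := by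
  obtain ⟨w, hw, hMw⟩ := Matrix.exists_mulVec_eq_zero_iff.2 h
  have hA : A.mulVec ![w 0, w 1, w 2, w 3] = -w 4 • u := by
    ext i
    have h0 := congrFun hMw (Fin.castLE (by norm_num) i)
    fin_cases i <;>
    · simp [Matrix.mulVec, dotProduct, Fin.sum_univ_six, Fin.sum_univ_four, complexBigM] at h0 ⊢
      linear_combination h0
  have hB : B.mulVec ![w 0, w 1, w 2, w 3] = -w 5 • v := by
    ext i
    have h0 := congrFun hMw (Fin.natAdd 3 i)
    fin_cases i <;>
    · simp [Matrix.mulVec, dotProduct, Fin.sum_univ_six, Fin.sum_univ_four, complexBigM] at h0 ⊢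
      linear_combination h0
  refine ⟨![w 0, w 1, w 2, w 3], ?_, ?_, ?_⟩
  · intro hz
    rw [hz, Matrix.mulVec_zero] at hA hB
    have h4 : w 4 = 0 := by simpa [hu] using hA.symm
    have h5 : w 5 = 0 := by simpa [hv] using hB.symm
    apply hw
    ext i
    fin_cases i
    exacts [congrFun hz 0, congrFun hz 1, congrFun hz 2, congrFun hz 3, h4, h5]
  · exact Submodule.mem_span_singleton.2 ⟨_, hA.symm⟩
  · exact Submodule.mem_span_singleton.2 ⟨_, hB.symm⟩

lemma mulVecLin_cx_surjective {A : Matrix (Fin 3) (Fin 4) ℝ} (hA : A.rank = 3) :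
    Function.Surjective (cx A).mulVecLin := by
  have hsurj : Function.Surjective A.mulVec := by
    change Function.Surjective A.mulVecLin
    rw [← LinearMap.range_eq_top]
    apply Submodule.eq_top_of_finrank_eq
    rw [Module.finrank_fin_fun]
    exact hA
  obtain ⟨B, hB⟩ := Matrix.mulVec_surjective_iff_exists_right_inverse.1 hsurj
  apply Matrix.mulVec_surjective_iff_exists_right_inverse.2
  refine ⟨cx B, ?_⟩
  have hmap : (A * B).map Complex.ofRealHom = cx A * cx B := Matrix.map_mul
  rw [← hmap, hB, Matrix.map_one _ (map_zero _) (map_one _)]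

/-- The preimage of a subspace under a surjective map has dimension increased by the nullity. -/
lemma finrank_comap_of_surjective {K V W : Type*} [Field K] [AddCommGroup V] [Module K V]
    [FiniteDimensional K V] [AddCommGroup W] [Module K W] {f : V →ₗ[K] W}
    (hf : Function.Surjective f) (S : Submodule K W) :
    Module.finrank K (S.comap f) = Module.finrank K S + Module.finrank K (LinearMap.ker f) := by
  have h := LinearMap.finrank_range_add_finrank_ker (f.domRestrict (S.comap f))
  have hr : LinearMap.range (f.domRestrict (S.comap f)) = S := by
    rw [LinearMap.range_domRestrict, Submodule.map_comap_eq_of_surjective hf]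
  have hle : LinearMap.ker f ≤ S.comap f := LinearMap.ker_le_comap f
  rw [hr, LinearMap.ker_domRestrict,
    (Submodule.comapSubtypeEquivOfLe hle).finrank_eq] at h
  exact h.symm

/-- Three pairwise meeting projective lines are concurrent or coplanar. -/
lemma concurrent_or_coplanar {K V : Type*} [Field K] [AddCommGroup V] [Module K V]
    [FiniteDimensional K V] {S T U : Submodule K V} (hS : Module.finrank K S = 2)
    (hT : Module.finrank K T = 2) (hU : Module.finrank K U = 2) (hST : S ⊓ T ≠ ⊥)
    (hSU : S ⊓ U ≠ ⊥) (hTU : T ⊓ U ≠ ⊥) :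
    S ⊓ T ⊓ U ≠ ⊥ ∨ Module.finrank K ↥(S ⊔ T ⊔ U) ≤ 3 := by
  refine or_iff_not_imp_left.2 fun h => ?_
  rw [not_not] at h
  have h1 := Submodule.one_le_finrank_iff.2 hST
  have h2 := Submodule.one_le_finrank_iff.2 hSU
  have h3 := Submodule.one_le_finrank_iff.2 hTU
  have hinf : (S ⊓ U) ⊓ (T ⊓ U) = ⊥ := by rw [← inf_inf_distrib_right, h]
  have hd := Submodule.finrank_sup_add_finrank_inf_eq (S ⊓ U) (T ⊓ U)
  rw [hinf, finrank_bot] at hd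
  have hUeq : (S ⊓ U) ⊔ (T ⊓ U) = U :=
    Submodule.eq_of_le_of_finrank_le (sup_le inf_le_right inf_le_right) (by omega)
  have hle : U ≤ S ⊔ T := by
    rw [← hUeq]
    exact sup_le_sup inf_le_left inf_le_left
  rw [sup_eq_left.2 hle]
  have := Submodule.finrank_sup_add_finrank_inf_eq S T
  omega

theorem statement10
    (P Q : Fin 3 → Matrix (Fin 3) (Fin 4) ℝ)
    (hPrank : ∀ i, (P i).rank = 3) (hQrank : ∀ i, (Q i).rank = 3)
    (hPdist : ∀ i j : Fin 3, i ≠ j → ∀ z : P3, IsCenter (P i) z → ¬ IsCenter (P j) z)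
    (hQdist : ∀ i j : Fin 3, i ≠ j → ∀ z : P3, IsCenter (Q i) z → ¬ IsCenter (Q j) z)
    (ξ : Fin 4 → ℂ) (hξ : ξ ≠ 0)
    (hnc : ∀ i, (cx (P i)).mulVec ξ ≠ 0)
    (L : Fin 3 → Submodule ℂ (Fin 4 → ℂ))
    (hL : ∀ i, L i = Submodule.comap ((cx (Q i)).mulVecLin)
        (Submodule.span ℂ {(cx (P i)).mulVec ξ}))
    (FQ : Fin 3 → Fin 3 → Matrix (Fin 3) (Fin 3) ℝ)
    (hFQ : ∀ i j : Fin 3, i < j → IsFundamental (Q i) (Q j) (FQ i j))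
    (hvan : ∀ i j : Fin 3, i < j →
      ((cx (P i)).mulVec ξ) ⬝ᵥ ((cx (FQ i j)).mulVec ((cx (P j)).mulVec ξ)) = 0) :
    (∀ i, Module.finrank ℂ ↥(L i) = 2) ∧
    ((L 0 ⊓ L 1 ⊓ L 2 ≠ ⊥) ∨ Module.finrank ℂ ↥(L 0 ⊔ L 1 ⊔ L 2) ≤ 3) := by
  have hdim : ∀ i, Module.finrank ℂ ↥(L i) = 2 := by
    intro i
    have hs := mulVecLin_cx_surjective (hQrank i)
    have hk := LinearMap.finrank_range_add_finrank_ker (cx (Q i)).mulVecLin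
    rw [LinearMap.range_eq_top.2 hs, finrank_top, Module.finrank_fin_fun,
      Module.finrank_fin_fun] at hk
    rw [hL i, finrank_comap_of_surjective hs, finrank_span_singleton (hnc i)]
    omega
  have hmeet : ∀ i j : Fin 3, i < j → L i ⊓ L j ≠ ⊥ := by
    intro i j hij
    have hdet := hvan i j hij
    rw [(hFQ i j hij).dotProduct_complex] at hdet
    obtain ⟨z, hz, hzi, hzj⟩ :=
      exists_ne_zero_of_det_complexBigM_eq_zero (hnc i) (hnc j) hdet
    rw [hL i, hL j]
    exact (Submodule.ne_bot_iff _).2 ⟨z, ⟨hzi, hzj⟩, hz⟩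
  exact ⟨hdim, concurrent_or_coplanar (hdim 0) (hdim 1) (hdim 2) (hmeet 0 1 (by decide))
    (hmeet 0 2 (by decide)) (hmeet 1 2 (by decide))⟩
end
end

section
/- Let P₁,P₂,P₃ be cameras with pairwise distinct camera centers, and let v₁,v₂,v₃ ∈ ℝ⁴ span their kernels. Consider the linear map Ψ from the 27-dimensional space of trilinear forms T on ℂ³ × ℂ³ × ℂ³ to the space of homogeneous cubic polynomials on ℂ⁴, given by Ψ(T)(X) = T(P₁X, P₂X, P₃X). Then the image of Ψ is contained in the 17-dimensional space of cubic forms vanishing at v₁, v₂ and v₃, and the kernel of Ψ has dimension at least 10. -/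
open Matrix

noncomputable section

/-- The linear map Ψ taking a trilinear form `T` on `ℂ³ × ℂ³ × ℂ³` (given by its
coefficient tensor) to the cubic form `X ↦ T(P₁X, P₂X, P₃X)` on `ℂ⁴`. -/
def Psi (P₁ P₂ P₃ : Matrix (Fin 3) (Fin 4) ℝ) :
    (Fin 3 → Fin 3 → Fin 3 → ℂ) →ₗ[ℂ] ((Fin 4 → ℂ) → ℂ) where
  toFun T := fun X => ∑ a : Fin 3, ∑ b : Fin 3, ∑ c : Fin 3,
    T a b c * (cx P₁).mulVec X a * (cx P₂).mulVec X b * (cx P₃).mulVec X c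
  map_add' T T' := by
    funext X
    simp only [Pi.add_apply, add_mul, Finset.sum_add_distrib]
  map_smul' s T := by
    funext X
    simp only [Pi.smul_apply, smul_eq_mul, RingHom.id_apply, Finset.mul_sum, mul_assoc]

/-- The space of cubic forms on `ℂⁿ`, as functions: the span of the monomials of degree 3. -/
def cubicForms (n : ℕ) : Submodule ℂ ((Fin n → ℂ) → ℂ) :=
  Submodule.span ℂ (Set.range fun (s : Sym (Fin n) 3) (X : Fin n → ℂ) =>
    ((s : Multiset (Fin n)).map X).prod)

instance (n : ℕ) : FiniteDimensional ℂ (cubicForms n) :=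
  FiniteDimensional.span_of_finite ℂ (Set.finite_range _)

theorem finrank_cubicForms_le (n : ℕ) :
    Module.finrank ℂ (cubicForms n) ≤ n.multichoose 3 := by
  refine (finrank_range_le_card _).trans ?_
  rw [Sym.card_sym_eq_multichoose, Fintype.card_fin]

theorem monomial_mem_cubicForms {n : ℕ} (i j k : Fin n) :
    (fun X : Fin n → ℂ => X i * X j * X k) ∈ cubicForms n := by
  refine Submodule.subset_span ⟨⟨{i, j, k}, rfl⟩, ?_⟩
  funext X
  simp [mul_assoc]

theorem dotProduct_mul_mem_cubicForms {n : ℕ} (a b c : Fin n → ℂ) :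
    (fun X => (a ⬝ᵥ X) * (b ⬝ᵥ X) * (c ⬝ᵥ X)) ∈ cubicForms n := by
  have h : (fun X => (a ⬝ᵥ X) * (b ⬝ᵥ X) * (c ⬝ᵥ X)) =
      ∑ i, ∑ j, ∑ k, (a i * b j * c k) • fun X : Fin n → ℂ => X i * X j * X k := by
    funext X
    simp only [dotProduct, Finset.sum_apply, Pi.smul_apply, smul_eq_mul]
    rw [Finset.sum_mul_sum, Finset.sum_mul]
    refine Finset.sum_congr rfl fun i _ => ?_
    rw [Finset.sum_mul_sum]
    exact Finset.sum_congr rfl fun j _ => Finset.sum_congr rfl fun k _ => by ring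
  rw [h]
  exact Submodule.sum_mem _ fun i _ => Submodule.sum_mem _ fun j _ =>
    Submodule.sum_mem _ fun k _ => Submodule.smul_mem _ _ (monomial_mem_cubicForms i j k)

theorem Psi_mem_cubicForms (P₁ P₂ P₃ : Matrix (Fin 3) (Fin 4) ℝ)
    (T : Fin 3 → Fin 3 → Fin 3 → ℂ) : Psi P₁ P₂ P₃ T ∈ cubicForms 4 := by
  have h : Psi P₁ P₂ P₃ T = ∑ a, ∑ b, ∑ c, T a b c •
      fun X => (cx P₁ a ⬝ᵥ X) * (cx P₂ b ⬝ᵥ X) * (cx P₃ c ⬝ᵥ X) := by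
    funext X
    simp only [Psi, LinearMap.coe_mk, AddHom.coe_mk, Finset.sum_apply, Pi.smul_apply,
      smul_eq_mul, mulVec, mul_assoc]
  rw [h]
  exact Submodule.sum_mem _ fun a _ => Submodule.sum_mem _ fun b _ =>
    Submodule.sum_mem _ fun c _ => Submodule.smul_mem _ _ (dotProduct_mul_mem_cubicForms _ _ _)

theorem cx_mulVec_ofReal {m n : Type*} [Fintype n] (A : Matrix m n ℝ) (x : n → ℝ) :
    (cx A).mulVec (fun k => (x k : ℂ)) = fun k => (A.mulVec x k : ℂ) := by
  funext k
  simp [cx, mulVec, dotProduct]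

/-- A linear form separating `x` from a nonzero vector `y` not proportional to it. -/
theorem exists_dotProduct_separating {n : ℕ} {x y : Fin n → ℝ} (hy : y ≠ 0)
    (hxy : ∀ l : ℝ, x ≠ l • y) :
    ∃ w : Fin n → ℂ, w ⬝ᵥ (fun k => (x k : ℂ)) ≠ 0 ∧ w ⬝ᵥ (fun k => (y k : ℂ)) = 0 := by
  obtain ⟨k, hk⟩ := Function.ne_iff.mp hy
  obtain ⟨j, hj⟩ := Function.ne_iff.mp (hxy (x k / y k))
  refine ⟨Pi.single j (y k : ℂ) - Pi.single k (y j : ℂ), ?_, ?_⟩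
  · rw [sub_dotProduct, single_dotProduct, single_dotProduct]
    norm_cast
    intro h
    apply hj
    simp only [Pi.zero_apply] at hk
    simp only [Pi.smul_apply, smul_eq_mul]
    field_simp
    linarith
  · rw [sub_dotProduct, single_dotProduct, single_dotProduct]
    ring

/-- Evaluation of cubic forms at the points `v i`. -/
def cubicEval {ι : Type*} {n : ℕ} (v : ι → Fin n → ℝ) : cubicForms n →ₗ[ℂ] (ι → ℂ) :=
  (LinearMap.funLeft ℂ ℂ fun i k => (v i k : ℂ)).domRestrict (cubicForms n)

theorem cubicEval_apply {ι : Type*} {n : ℕ} (v : ι → Fin n → ℝ) (f : cubicForms n) (i : ι) :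
    cubicEval v f i = (f : (Fin n → ℂ) → ℂ) fun k => (v i k : ℂ) := rfl

theorem cubicEval_surjective {n : ℕ} {v : Fin 3 → Fin n → ℝ} (hv : ∀ i, v i ≠ 0)
    (hdist : ∀ i j : Fin 3, i ≠ j → ∀ l : ℝ, v j ≠ l • v i) :
    Function.Surjective (cubicEval v) := by
  have key : ∀ i, ∃ f : cubicForms n, cubicEval v f = Pi.single i 1 := by
    intro i
    obtain ⟨j, k, hij, hik, hcover⟩ :
        ∃ j k : Fin 3, j ≠ i ∧ k ≠ i ∧ ∀ m, m = i ∨ m = j ∨ m = k := by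
      revert i; decide
    obtain ⟨a, hai, haj⟩ := exists_dotProduct_separating (hv j) (hdist j i hij)
    obtain ⟨b, hbi, hbk⟩ := exists_dotProduct_separating (hv k) (hdist k i hik)
    let x : Fin n → ℂ := fun l => (v i l : ℂ)
    refine ⟨((a ⬝ᵥ x) * (a ⬝ᵥ x) * (b ⬝ᵥ x))⁻¹ •
      ⟨_, dotProduct_mul_mem_cubicForms a a b⟩, ?_⟩
    funext m
    rw [map_smul, Pi.smul_apply, cubicEval_apply]
    rcases hcover m with rfl | rfl | rfl
    · simp only [Pi.single_eq_same, smul_eq_mul]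
      exact inv_mul_cancel₀ (mul_ne_zero (mul_ne_zero hai hai) hbi)
    · simp [haj, hij]
    · simp [hbk, hik]
  choose f hf using key
  intro y
  refine ⟨∑ i, y i • f i, ?_⟩
  simp only [map_sum, map_smul, hf]
  exact (pi_eq_sum_univ' y).symm

theorem finrank_ker_cubicEval_le {v : Fin 3 → Fin 4 → ℝ} (hv : ∀ i, v i ≠ 0)
    (hdist : ∀ i j : Fin 3, i ≠ j → ∀ l : ℝ, v j ≠ l • v i) :
    Module.finrank ℂ (LinearMap.ker (cubicEval v)) ≤ 17 := by
  have h := (cubicEval v).finrank_range_add_finrank_ker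
  rw [LinearMap.range_eq_top.mpr (cubicEval_surjective hv hdist), finrank_top,
    Module.finrank_fin_fun] at h
  have h20 : Module.finrank ℂ (cubicForms 4) ≤ 20 :=
    (finrank_cubicForms_le 4).trans_eq (by rw [Nat.multichoose_eq]; rfl)
  omega

theorem Psi_apply_center (P : Fin 3 → Matrix (Fin 3) (Fin 4) ℝ) (v : Fin 3 → Fin 4 → ℝ)
    (hk : ∀ i, (P i).mulVec (v i) = 0) (T : Fin 3 → Fin 3 → Fin 3 → ℂ) (i : Fin 3) :
    Psi (P 0) (P 1) (P 2) T (fun k => (v i k : ℂ)) = 0 := by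
  have h : (cx (P i)).mulVec (fun k => (v i k : ℂ)) = 0 := by
    rw [cx_mulVec_ofReal, hk]
    simp only [Pi.zero_apply, Complex.ofReal_zero]
    rfl
  fin_cases i <;> simp_all [Psi]

theorem statement11
    (P : Fin 3 → Matrix (Fin 3) (Fin 4) ℝ)
    (hrank : ∀ i, (P i).rank = 3)
    (v : Fin 3 → Fin 4 → ℝ)
    (hv : ∀ i, v i ≠ 0) (hk : ∀ i, (P i).mulVec (v i) = 0)
    (hdist : ∀ i j : Fin 3, i ≠ j → ∀ l : ℝ, v j ≠ l • v i) :
    (∀ T : Fin 3 → Fin 3 → Fin 3 → ℂ, ∀ i : Fin 3,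
      Psi (P 0) (P 1) (P 2) T (fun k => (v i k : ℂ)) = 0) ∧
    10 ≤ Module.finrank ℂ ↥(LinearMap.ker (Psi (P 0) (P 1) (P 2))) := by
  refine ⟨Psi_apply_center P v hk, ?_⟩
  let Ψ := Psi (P 0) (P 1) (P 2)
  have hle : LinearMap.range Ψ ≤ (LinearMap.ker (cubicEval v)).map (cubicForms 4).subtype := by
    rintro _ ⟨T, rfl⟩
    refine ⟨⟨Ψ T, Psi_mem_cubicForms _ _ _ T⟩, ?_, rfl⟩
    exact funext fun i => Psi_apply_center P v hk T i
  have hrange : Module.finrank ℂ (LinearMap.range Ψ) ≤ 17 :=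
    (Submodule.finrank_mono hle).trans
      ((Submodule.finrank_map_le _ _).trans (finrank_ker_cubicEval_le hv hdist))
  have hdim := Ψ.finrank_range_add_finrank_ker
  have h27 : Module.finrank ℂ (Fin 3 → Fin 3 → Fin 3 → ℂ) = 27 := by
    simp [Module.finrank_pi_fintype]
  change 10 ≤ Module.finrank ℂ (LinearMap.ker Ψ)
  omega
end
end

section
/- Let C ⊂ ℙ³ be a twisted cubic, let l be a projective line that is not a secant of C, and let p be a point on l not lying on C. Then there exists a point x ∈ C such that for every point q ∈ l with q ≠ p and q ∉ C, every quadratic form S on ℂ⁴ that vanishes identically on C and vanishes at p and at q also vanishes identically on the projective line spanned by x and q. -/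
open Matrix

noncomputable section

/-- The parameter vector `[s³ : s²t : st² : t³]` of the standard twisted cubic. -/
def cubicVec (s t : ℂ) : Fin 4 → ℂ := ![s ^ 3, s ^ 2 * t, s * t ^ 2, t ^ 3]

/-- The twisted cubic `H · {[s³ : s²t : st² : t³]}` determined by `H ∈ GL₄(ℝ)`. -/
def TwistedCubic (H : Matrix (Fin 4) (Fin 4) ℝ) : Set P3 :=
  {z | ∃ s t : ℂ, ¬(s = 0 ∧ t = 0) ∧
    z.rep ∈ Submodule.span ℂ {(cx H).mulVec (cubicVec s t)}}

/-- The tangent line of the twisted cubic determined by `H` at the point with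
parameter `[s : t]`. -/
def IsTangentLine (H : Matrix (Fin 4) (Fin 4) ℝ)
    (W : Submodule ℂ (Fin 4 → ℂ)) : Prop :=
  ∃ s t : ℂ, ¬(s = 0 ∧ t = 0) ∧
    W = Submodule.span ℂ
      {(cx H).mulVec ![3 * s ^ 2, 2 * s * t, t ^ 2, 0],
       (cx H).mulVec ![0, s ^ 2, 2 * s * t, 3 * t ^ 2]}

/-- The line `ℙ(W)` is a secant of the twisted cubic determined by `H`: it contains two
distinct points of the cubic, or it is one of its tangent lines. -/
def IsSecant (H : Matrix (Fin 4) (Fin 4) ℝ) (W : Submodule ℂ (Fin 4 → ℂ)) : Prop :=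
  (∃ z₁ z₂ : P3, z₁ ∈ TwistedCubic H ∧ z₂ ∈ TwistedCubic H ∧ z₁ ≠ z₂ ∧
    z₁.rep ∈ W ∧ z₂.rep ∈ W) ∨ IsTangentLine H W

/-- The three quadratic forms cutting out the standard twisted cubic. -/
def hess (y : Fin 4 → ℂ) : Fin 3 → ℂ :=
  ![y 0 * y 2 - y 1 ^ 2, y 0 * y 3 - y 1 * y 2, y 1 * y 3 - y 2 ^ 2]

/-- The polarization of `hess`. -/
def hessPolar (y z : Fin 4 → ℂ) : Fin 3 → ℂ :=
  ![y 0 * z 2 + z 0 * y 2 - 2 * (y 1 * z 1),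
    y 0 * z 3 + z 0 * y 3 - y 1 * z 2 - z 1 * y 2,
    y 1 * z 3 + z 1 * y 3 - 2 * (y 2 * z 2)]

/-- The contraction of a binary cubic by a binary quadratic form. -/
def contract (h : Fin 3 → ℂ) : (Fin 4 → ℂ) →ₗ[ℂ] (Fin 2 → ℂ) where
  toFun r := ![h 2 * r 0 - h 1 * r 1 + h 0 * r 2, h 2 * r 1 - h 1 * r 2 + h 0 * r 3]
  map_add' x y := by ext i; fin_cases i <;> simp <;> ring
  map_smul' c x := by ext i; fin_cases i <;> simp <;> ring

lemma contract_apply (h : Fin 3 → ℂ) (r : Fin 4 → ℂ) :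
    contract h r =
      ![h 2 * r 0 - h 1 * r 1 + h 0 * r 2, h 2 * r 1 - h 1 * r 2 + h 0 * r 3] := rfl

lemma contract_hess_self (y : Fin 4 → ℂ) : contract (hess y) y = 0 := by
  ext i; fin_cases i <;> simp [contract_apply, hess] <;> ring

lemma contract_surjective {h : Fin 3 → ℂ} (hh : h ≠ 0) :
    Function.Surjective (contract h) := by
  intro v
  by_cases h2 : h 2 = 0
  · by_cases h0 : h 0 = 0
    · have h1 : h 1 ≠ 0 := fun h1 => hh (by ext i; fin_cases i <;> assumption)
      refine ⟨![0, -v 0 / h 1, -v 1 / h 1, 0], ?_⟩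
      ext i; fin_cases i <;> simp [contract_apply, h0, h2] <;> field_simp
    · refine ⟨![0, 0, v 0 / h 0, (v 1 + h 1 * (v 0 / h 0)) / h 0], ?_⟩
      ext i; fin_cases i <;> simp [contract_apply, h2] <;> grind
  · refine ⟨![(v 0 + h 1 * (v 1 / h 2)) / h 2, v 1 / h 2, 0, 0], ?_⟩
    ext i; fin_cases i <;> simp [contract_apply] <;> grind

lemma finrank_ker_contract {h : Fin 3 → ℂ} (hh : h ≠ 0) :
    Module.finrank ℂ (LinearMap.ker (contract h)) = 2 := by
  have h1 := LinearMap.finrank_range_add_finrank_ker (contract h)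
  rw [LinearMap.range_eq_top.2 (contract_surjective hh), finrank_top] at h1
  simp at h1
  omega

lemma cubicVec_ne_zero {s t : ℂ} (h : ¬(s = 0 ∧ t = 0)) : cubicVec s t ≠ 0 := by
  intro h0
  exact h ⟨by simpa [cubicVec] using congrFun h0 0, by simpa [cubicVec] using congrFun h0 3⟩

lemma cubicVec_mul (c s t : ℂ) : cubicVec (c * s) (c * t) = c ^ 3 • cubicVec s t := by
  ext i; fin_cases i <;> simp [cubicVec] <;> ring

/-- A vector annihilated by the quadrics lies on the cone over the twisted cubic. -/
lemma exists_eq_smul_cubicVec {y : Fin 4 → ℂ} (h : hess y = 0) :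
    ∃ s t c : ℂ, ¬(s = 0 ∧ t = 0) ∧ y = c • cubicVec s t := by
  have e0 : y 0 * y 2 - y 1 ^ 2 = 0 := congrFun h 0
  have e1 : y 0 * y 3 - y 1 * y 2 = 0 := congrFun h 1
  have e2 : y 1 * y 3 - y 2 ^ 2 = 0 := congrFun h 2
  by_cases h0 : y 0 = 0
  · have h1 : y 1 = 0 := by simpa [h0] using e0
    have h2 : y 2 = 0 := by simpa [h1] using e2
    refine ⟨0, 1, y 3, by simp, ?_⟩
    ext i; fin_cases i <;> simp [cubicVec, h0, h1, h2]
  · refine ⟨y 0, y 1, (y 0 ^ 2)⁻¹, by simp [h0], ?_⟩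
    rw [eq_inv_smul_iff₀ (pow_ne_zero 2 h0)]
    ext i; fin_cases i <;> simp [cubicVec]
    · ring
    · linear_combination y 0 * e0
    · linear_combination y 0 * e1 + y 1 * e0

lemma cubicVec_mem_ker_contract {h : Fin 3 → ℂ} {s t : ℂ}
    (hr : h 2 * s ^ 2 - h 1 * s * t + h 0 * t ^ 2 = 0) :
    cubicVec s t ∈ LinearMap.ker (contract h) := by
  rw [LinearMap.mem_ker]
  ext i; fin_cases i <;> simp [contract_apply, cubicVec]
  · linear_combination s * hr
  · linear_combination t * hr

/-- A nonzero binary quadratic form has two distinct roots or a double root. -/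
lemma exists_roots {h : Fin 3 → ℂ} (hh : h ≠ 0) :
    (∃ s₁ t₁ s₂ t₂ : ℂ, s₁ * t₂ ≠ s₂ * t₁ ∧
      h 2 * s₁ ^ 2 - h 1 * s₁ * t₁ + h 0 * t₁ ^ 2 = 0 ∧
      h 2 * s₂ ^ 2 - h 1 * s₂ * t₂ + h 0 * t₂ ^ 2 = 0) ∨
    ∃ s t : ℂ, ¬(s = 0 ∧ t = 0) ∧ 2 * h 2 * s = h 1 * t ∧ h 1 * s = 2 * h 0 * t := by
  obtain ⟨d, hd⟩ := IsAlgClosed.exists_pow_nat_eq (h 1 ^ 2 - 4 * h 0 * h 2) (n := 2) (by norm_num)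
  by_cases d0 : d = 0
  · right
    subst d0
    by_cases hc : h 1 = 0 ∧ h 2 = 0
    · refine ⟨2 * h 0, h 1, fun h' => hh ?_, by linear_combination hd, by ring⟩
      ext i; fin_cases i
      · simpa using h'.1
      · exact hc.1
      · exact hc.2
    · exact ⟨h 1, 2 * h 2, by simpa using hc, by ring, by linear_combination -hd⟩
  · left
    by_cases h2 : h 2 = 0
    · refine ⟨1, 0, h 0, h 1, ?_, by simp [h2], by rw [h2]; ring⟩
      intro h1
      apply d0
      simp only [one_mul, mul_zero] at h1
      simpa [h1, h2] using hd
    · refine ⟨h 1 + d, 2 * h 2, h 1 - d, 2 * h 2, fun e => ?_, ?_, ?_⟩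
      · have : d * h 2 = 0 := by linear_combination e / 4
        simp_all
      · linear_combination h 2 * hd
      · linear_combination h 2 * hd

lemma cubicVec_ne_smul {s₁ t₁ s₂ t₂ : ℂ} (h : s₁ * t₂ ≠ s₂ * t₁) (c : ℂ) :
    c • cubicVec s₂ t₂ ≠ cubicVec s₁ t₁ := by
  intro e
  have e0 : c * s₂ ^ 3 = s₁ ^ 3 := congrFun e 0
  have e1 : c * (s₂ ^ 2 * t₂) = s₁ ^ 2 * t₁ := congrFun e 1
  have e2 : c * (s₂ * t₂ ^ 2) = s₁ * t₁ ^ 2 := congrFun e 2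
  have e3 : c * t₂ ^ 3 = t₁ ^ 3 := congrFun e 3
  have : (s₁ * t₂ - s₂ * t₁) ^ 3 = 0 := by
    linear_combination -t₂ ^ 3 * e0 + 3 * t₂ ^ 2 * s₂ * e1 - 3 * t₂ * s₂ ^ 2 * e2 + s₂ ^ 3 * e3
  exact h (sub_eq_zero.1 (pow_eq_zero_iff (by norm_num) |>.1 this))

lemma linearIndependent_tangent {s t : ℂ} (h : ¬(s = 0 ∧ t = 0)) :
    LinearIndependent ℂ
      ![![3 * s ^ 2, 2 * s * t, t ^ 2, 0], ![0, s ^ 2, 2 * s * t, 3 * t ^ 2]] := by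
  rw [LinearIndependent.pair_iff]
  intro a b e
  have e0 : a * (3 * s ^ 2) = 0 := by simpa using congrFun e 0
  have e1 : a * (2 * s * t) + b * s ^ 2 = 0 := by simpa using congrFun e 1
  have e2 : a * t ^ 2 + b * (2 * s * t) = 0 := by simpa using congrFun e 2
  have e3 : b * (3 * t ^ 2) = 0 := by simpa using congrFun e 3
  by_cases hs : s = 0
  · have ht : t ≠ 0 := fun ht => h ⟨hs, ht⟩
    subst hs
    simp_all
  · have ha : a = 0 := by simpa [hs] using e0
    subst ha
    simp_all

lemma finrank_span_pair {v w : Fin 4 → ℂ} (h : LinearIndependent ℂ ![v, w]) :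
    Module.finrank ℂ (Submodule.span ℂ {v, w}) = 2 := by
  have hr : Set.range ![v, w] = {v, w} := Matrix.range_cons_cons_empty v w ![]
  rw [← hr, finrank_span_eq_card h, Fintype.card_fin]

lemma tangent_mem_ker_contract {h : Fin 3 → ℂ} {s t : ℂ}
    (h₁ : 2 * h 2 * s = h 1 * t) (h₂ : h 1 * s = 2 * h 0 * t) :
    ![3 * s ^ 2, 2 * s * t, t ^ 2, 0] ∈ LinearMap.ker (contract h) ∧
    ![0, s ^ 2, 2 * s * t, 3 * t ^ 2] ∈ LinearMap.ker (contract h) := by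
  constructor <;> rw [LinearMap.mem_ker] <;> ext i <;> fin_cases i <;>
    simp [contract_apply]
  · linear_combination (3 / 2) * s * h₁ - (1 / 2) * t * h₂
  · linear_combination t * h₁
  · linear_combination -s * h₂
  · linear_combination (1 / 2) * s * h₁ - (3 / 2) * t * h₂

lemma isUnit_cx {H : Matrix (Fin 4) (Fin 4) ℝ} (hH : IsUnit H) : IsUnit (cx H) :=
  hH.map (Complex.ofRealHom.mapMatrix (m := Fin 4))

lemma rep_mk_mem_iff {v : Fin 4 → ℂ} (hv : v ≠ 0) (W : Submodule ℂ (Fin 4 → ℂ)) :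
    (Projectivization.mk ℂ v hv).rep ∈ W ↔ v ∈ W := by
  obtain ⟨a, ha⟩ := Projectivization.exists_smul_eq_mk_rep ℂ v hv
  rw [← ha]
  exact W.smul_mem_iff' a

lemma mulVec_cubicVec_ne_zero {H : Matrix (Fin 4) (Fin 4) ℝ} (hH : IsUnit H) {s t : ℂ}
    (h : ¬(s = 0 ∧ t = 0)) : (cx H).mulVec (cubicVec s t) ≠ 0 := by
  rw [← Matrix.mulVec_zero (cx H)]
  exact (Matrix.mulVec_injective_of_isUnit (isUnit_cx hH)).ne (cubicVec_ne_zero h)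

lemma mk_mem_twistedCubic {H : Matrix (Fin 4) (Fin 4) ℝ} (hH : IsUnit H) {s t : ℂ}
    (h : ¬(s = 0 ∧ t = 0)) :
    Projectivization.mk ℂ _ (mulVec_cubicVec_ne_zero hH h) ∈ TwistedCubic H :=
  ⟨s, t, h, (rep_mk_mem_iff _ _).2 (Submodule.mem_span_singleton_self _)⟩

/-- The kernel of the contraction by a nonzero quadratic form is a secant line. -/
lemma isSecant_map_ker_contract {H : Matrix (Fin 4) (Fin 4) ℝ} (hH : IsUnit H)
    {h : Fin 3 → ℂ} (hh : h ≠ 0) :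
    IsSecant H ((LinearMap.ker (contract h)).map (cx H).mulVecLin) := by
  have inj := Matrix.mulVec_injective_of_isUnit (isUnit_cx hH)
  rcases exists_roots hh with ⟨s₁, t₁, s₂, t₂, hne, r₁, r₂⟩ | ⟨s, t, hst, r₁, r₂⟩
  · left
    have n₁ : ¬(s₁ = 0 ∧ t₁ = 0) := by rintro ⟨rfl, rfl⟩; simp at hne
    have n₂ : ¬(s₂ = 0 ∧ t₂ = 0) := by rintro ⟨rfl, rfl⟩; simp at hne
    refine ⟨_, _, mk_mem_twistedCubic hH n₁, mk_mem_twistedCubic hH n₂, fun e => ?_,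
      (rep_mk_mem_iff _ _).2 (Submodule.mem_map_of_mem (cubicVec_mem_ker_contract r₁)),
      (rep_mk_mem_iff _ _).2 (Submodule.mem_map_of_mem (cubicVec_mem_ker_contract r₂))⟩
    rw [Projectivization.mk_eq_mk_iff'] at e
    obtain ⟨a, ha⟩ := e
    rw [← Matrix.mulVec_smul] at ha
    exact cubicVec_ne_smul hne a (inj ha)
  · right
    refine ⟨s, t, hst, ?_⟩
    obtain ⟨m₁, m₂⟩ := tangent_mem_ker_contract r₁ r₂
    have hspan : LinearMap.ker (contract h) = Submodule.span ℂ
        {![3 * s ^ 2, 2 * s * t, t ^ 2, 0], ![0, s ^ 2, 2 * s * t, 3 * t ^ 2]} := by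
      refine (Submodule.eq_of_le_of_finrank_eq ?_ ?_).symm
      · rw [Submodule.span_le]
        rintro v (rfl | rfl) <;> assumption
      · rw [finrank_ker_contract hh]
        exact finrank_span_pair (linearIndependent_tangent hst)
    rw [hspan, Submodule.map_span, Set.image_pair]
    rfl

/-- A quadratic form vanishing on the standard twisted cubic is a combination of the
components of `hess`. -/
lemma exists_eq_hessPolar {T : Matrix (Fin 4) (Fin 4) ℂ}
    (hT : ∀ s t : ℂ, ¬(s = 0 ∧ t = 0) → cubicVec s t ⬝ᵥ T.mulVec (cubicVec s t) = 0) :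
    ∃ l : Fin 3 → ℂ, (∀ y, y ⬝ᵥ T.mulVec y = l ⬝ᵥ hess y) ∧
      ∀ y z, y ⬝ᵥ T.mulVec z + z ⬝ᵥ T.mulVec y = l ⬝ᵥ hessPolar y z := by
  have e0 := hT 1 0 (by simp)
  have e1 := hT 1 1 (by simp)
  have e2 := hT 1 (-1) (by simp)
  have e3 := hT 1 2 (by simp)
  have e4 := hT 1 (-2) (by simp)
  have e5 := hT 1 3 (by simp)
  have e6 := hT 0 1 (by simp)
  simp [dotProduct, Matrix.mulVec, cubicVec, Fin.sum_univ_four] at e0 e1 e2 e3 e4 e5 e6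
  have c1 : T 0 1 + T 1 0 = 0 := by grind
  have c2 : T 0 2 + T 2 0 + T 1 1 = 0 := by grind
  have c3 : T 0 3 + T 3 0 + T 1 2 + T 2 1 = 0 := by grind
  have c4 : T 1 3 + T 3 1 + T 2 2 = 0 := by grind
  have c5 : T 2 3 + T 3 2 = 0 := by grind
  refine ⟨![T 0 2 + T 2 0, T 0 3 + T 3 0, T 1 3 + T 3 1], fun y => ?_, fun y z => ?_⟩ <;>
    simp [dotProduct, Matrix.mulVec, hess, hessPolar, Fin.sum_univ_four, Fin.sum_univ_three]
  · linear_combination y 0 ^ 2 * e0 + y 3 ^ 2 * e6 + y 0 * y 1 * c1 + y 1 ^ 2 * c2 +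
      y 1 * y 2 * c3 + y 2 ^ 2 * c4 + y 2 * y 3 * c5
  · linear_combination 2 * y 0 * z 0 * e0 + 2 * y 3 * z 3 * e6 +
      (y 0 * z 1 + z 0 * y 1) * c1 + 2 * y 1 * z 1 * c2 +
      (y 1 * z 2 + z 1 * y 2) * c3 + 2 * y 2 * z 2 * c4 + (y 2 * z 3 + z 2 * y 3) * c5

/-- For `u` the contraction of `q` by `hess p`, the vector `hessPolar u³ q` is a combination
of `hess q` and `hess p`. -/
lemma hessPolar_cubicVec_contract (p q : Fin 4 → ℂ) :
    ∃ c d : ℂ, hessPolar (cubicVec (contract (hess p) q 0) (contract (hess p) q 1)) q =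
      c • hess q + d • hess p := by
  set u := contract (hess p) q with hu
  refine ⟨hess p 2 * u 0 ^ 2 - hess p 1 * u 0 * u 1 + hess p 0 * u 1 ^ 2,
    -(hess q 2 * u 0 ^ 2 - hess q 1 * u 0 * u 1 + hess q 0 * u 1 ^ 2), ?_⟩
  rw [hu]
  ext i; fin_cases i <;> simp [contract_apply, hess, hessPolar, cubicVec] <;> ring

theorem statement13
    (H : Matrix (Fin 4) (Fin 4) ℝ) (hH : IsUnit H)
    (W : Submodule ℂ (Fin 4 → ℂ)) (hW : Module.finrank ℂ W = 2)
    (hsec : ¬ IsSecant H W)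
    (p : P3) (hpl : p.rep ∈ W) (hpC : p ∉ TwistedCubic H) :
    ∃ x ∈ TwistedCubic H,
      ∀ q : P3, q.rep ∈ W → q ≠ p → q ∉ TwistedCubic H →
        ∀ S : Matrix (Fin 4) (Fin 4) ℂ,
          (∀ z ∈ TwistedCubic H, z.rep ⬝ᵥ S.mulVec z.rep = 0) →
          p.rep ⬝ᵥ S.mulVec p.rep = 0 →
          q.rep ⬝ᵥ S.mulVec q.rep = 0 →
          ∀ a b : ℂ,
            (a • x.rep + b • q.rep) ⬝ᵥ S.mulVec (a • x.rep + b • q.rep) = 0 := by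
  have inj := Matrix.mulVec_injective_of_isUnit (isUnit_cx hH)
  have surj := Matrix.mulVec_surjective_iff_isUnit.2 (isUnit_cx hH)
  obtain ⟨p', hp'⟩ := surj p.rep
  have hh : hess p' ≠ 0 := by
    intro h
    obtain ⟨s, t, c, hst, rfl⟩ := exists_eq_smul_cubicVec h
    refine hpC ⟨s, t, hst, ?_⟩
    rw [← hp', Matrix.mulVec_smul]
    exact Submodule.smul_mem _ _ (Submodule.mem_span_singleton_self _)
  set K := (LinearMap.ker (contract (hess p'))).map (cx H).mulVecLin with hK
  have hKrank : Module.finrank ℂ K = 2 :=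
    (Submodule.equivMapOfInjective _ inj _).finrank_eq.symm.trans (finrank_ker_contract hh)
  have hWK : ¬ W ≤ K := fun hle => hsec <| by
    rw [Submodule.eq_of_le_of_finrank_eq hle (hW.trans hKrank.symm)]
    exact isSecant_map_ker_contract hH hh
  obtain ⟨r, hrW, hrK⟩ := Set.not_subset.1 hWK
  obtain ⟨r', hr'⟩ := surj r
  have hu : contract (hess p') r' ≠ 0 := fun h => hrK ⟨r', h, hr'⟩
  set u := contract (hess p') r' with hu_def
  have hu' : ¬(u 0 = 0 ∧ u 1 = 0) := fun h => hu (by ext i; fin_cases i; exacts [h.1, h.2])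
  have hpK : p.rep ∈ K := ⟨p', contract_hess_self p', hp'⟩
  have hind : LinearIndependent ℂ ![p.rep, r] := by
    rw [LinearIndependent.pair_iff' p.rep_nonzero]
    rintro a rfl
    exact hrK (K.smul_mem a hpK)
  have hspan : Submodule.span ℂ {p.rep, r} = W := by
    refine Submodule.eq_of_le_of_finrank_eq ?_ ?_
    · rw [Submodule.span_le]
      rintro v (rfl | rfl) <;> assumption
    · rw [hW, finrank_span_pair hind]
  refine ⟨_, mk_mem_twistedCubic hH hu', fun q hq hqp _ S hS hSp hSq a b => ?_⟩
  obtain ⟨k, hk⟩ := Projectivization.exists_smul_eq_mk_rep ℂ _ (mulVec_cubicVec_ne_zero hH hu')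
  rw [← hk, Units.smul_def]
  have hform : ∀ y z, (cx H).mulVec y ⬝ᵥ S.mulVec ((cx H).mulVec z) =
      y ⬝ᵥ ((cx H)ᵀ * S * cx H).mulVec z := by
    intro y z
    simp only [← Matrix.mulVec_mulVec]
    rw [Matrix.dotProduct_mulVec y, Matrix.vecMul_transpose]
  obtain ⟨l, hl, hlp⟩ := exists_eq_hessPolar (T := (cx H)ᵀ * S * cx H) (by
    intro s t hst
    have h := hS _ (mk_mem_twistedCubic hH hst)
    obtain ⟨k, hk⟩ :=
      Projectivization.exists_smul_eq_mk_rep ℂ _ (mulVec_cubicVec_ne_zero hH hst)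
    rw [← hk, Units.smul_def, Matrix.mulVec_smul, dotProduct_smul, smul_dotProduct, hform] at h
    simpa using h)
  obtain ⟨q', hq'⟩ := surj q.rep
  rw [← hspan, Submodule.mem_span_pair] at hq
  obtain ⟨α, β, hαβ⟩ := hq
  have hq'' : q' = α • p' + β • r' := by
    apply inj
    rw [hq', ← hαβ, Matrix.mulVec_add, Matrix.mulVec_smul, Matrix.mulVec_smul, hp', hr']
  have hβ : β ≠ 0 := by
    rintro rfl
    apply hqp
    rw [← q.mk_rep, ← p.mk_rep, Projectivization.mk_eq_mk_iff']
    exact ⟨α, by simpa using hαβ⟩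
  have huq : contract (hess p') q' = β • u := by
    rw [hq'', map_add, map_smul, map_smul, contract_hess_self, smul_zero, zero_add]
  have hxx : hess (cubicVec (u 0) (u 1)) = 0 := by
    ext i; fin_cases i <;> simp [hess, cubicVec] <;> ring
  rw [← hp', hform, hl] at hSp
  rw [← hq', hform, hl] at hSq
  have hpol : l ⬝ᵥ hessPolar (cubicVec (u 0) (u 1)) q' = 0 := by
    obtain ⟨c, d, hcd⟩ := hessPolar_cubicVec_contract p' q'
    have h : l ⬝ᵥ hessPolar (cubicVec (β * u 0) (β * u 1)) q' = 0 := by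
      rw [huq] at hcd
      simp only [Pi.smul_apply, smul_eq_mul] at hcd
      rw [hcd, dotProduct_add, dotProduct_smul, dotProduct_smul, hSp, hSq]
      simp
    rw [cubicVec_mul, ← hlp] at h
    rw [← hlp]
    simp only [Matrix.mulVec_smul, dotProduct_smul, smul_dotProduct, ← smul_add] at h
    simpa [hβ] using h
  have hxT := hl (cubicVec (u 0) (u 1))
  have hqT := hl q'
  rw [hxx, dotProduct_zero] at hxT
  rw [hSq] at hqT
  rw [← hlp] at hpol
  rw [← hq', ← Matrix.mulVec_smul, ← Matrix.mulVec_smul, ← Matrix.mulVec_smul,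
    ← Matrix.mulVec_add, hform]
  simp only [Matrix.mulVec_add, Matrix.mulVec_smul, dotProduct_add, add_dotProduct,
    dotProduct_smul, smul_dotProduct, smul_eq_mul]
  linear_combination (a * k) ^ 2 * hxT + a * k * b * hpol + b ^ 2 * hqT
end
end
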